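/- There exists an absolute constant C > 0 such that for every odd prime p and every real x ≥ 2, one has | ∑_{d ∣ (p−1), d > 2} (μ(d)/φ(d)) · ∑_{χ of order d} ∑_{m ≤ x, m square-full} χ(m) | ≤ C · 2^{ω(p−1)} · x^{1/3} · p^{1/9} · (log p)^{1/6} · (log x), where the middle sum is over Dirichlet characters χ modulo p of multiplicative order exactly d. -/

import Mathlib

/-- A positive integer `n` is square-full if every prime `q` dividing `n` satisfies `q^2 ∣ n`. -/
def Squarefull (n : ℕ) : Prop := ∀ q : ℕ, q.Prime → q ∣ n → q ^ 2 ∣ n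

section Stepanov

open Polynomial Finset

lemma exists_hasseDeriv_mul_pow_eq {R : Type*} [CommRing R] (f g : R[X]) (m s : ℕ) :
    ∃ q : R[X], q.natDegree ≤ g.natDegree + s * f.natDegree ∧
      hasseDeriv s (g * f ^ m) = f ^ (m - s) * q := by
  induction m generalizing s with
  | zero =>
    refine ⟨hasseDeriv s g, ?_, by simp⟩
    exact (natDegree_hasseDeriv_le g s).trans (by lia)
  | succ m ih =>
    rcases le_or_gt (m + 1) s with hs | hs
    · refine ⟨hasseDeriv s (g * f ^ (m + 1)), ?_, by
        rw [Nat.sub_eq_zero_of_le hs, pow_zero, one_mul]⟩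
      calc _ ≤ (g * f ^ (m + 1)).natDegree - s := natDegree_hasseDeriv_le _ s
        _ ≤ g.natDegree + (m + 1) * f.natDegree :=
          (Nat.sub_le _ _).trans (natDegree_mul_le.trans (by gcongr; exact natDegree_pow_le))
        _ ≤ _ := by gcongr
    · choose q hqd hq using ih
      refine ⟨∑ x ∈ antidiagonal s, (if x.2 = 0 then q x.1
        else f ^ (x.2 - 1) * q x.1 * hasseDeriv x.2 f), ?_, ?_⟩
      · refine natDegree_sum_le_of_forall_le _ _ fun x hx => ?_
        rw [HasAntidiagonal.mem_antidiagonal] at hx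
        split_ifs with h
        · rw [← hx, h]; simpa using hqd x.1
        · calc _ ≤ (x.2 - 1) * f.natDegree + (g.natDegree + x.1 * f.natDegree) + f.natDegree := by
                refine natDegree_mul_le.trans (add_le_add (natDegree_mul_le.trans
                  (add_le_add natDegree_pow_le (hqd _))) ?_)
                exact (natDegree_hasseDeriv_le _ _).trans (Nat.sub_le _ _)
            _ = _ := by
                obtain ⟨v, hv⟩ := Nat.exists_eq_succ_of_ne_zero h
                rw [← hx, hv]; simp; ring
      · rw [pow_succ, ← mul_assoc, hasseDeriv_mul, mul_sum]
        refine sum_congr rfl fun x hx => ?_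
        rw [HasAntidiagonal.mem_antidiagonal] at hx
        rw [hq]
        split_ifs with h
        · rw [h, hasseDeriv_zero', show m + 1 - s = m - x.1 + 1 by lia]; ring
        · rw [show m - x.1 = (m + 1 - s) + (x.2 - 1) by lia, pow_add]; ring

lemma X_pow_dvd_taylor_sub {K : Type*} [Field K] [Fintype K] (α : K) (j l : ℕ)
    (hl : l ≤ Fintype.card K) :
    (X : K[X]) ^ l ∣ taylor α (X ^ (j * Fintype.card K)) - taylor α (C (α ^ j)) := by
  obtain ⟨p, hchar⟩ := CharP.exists K
  obtain ⟨n, hp, hn⟩ := FiniteField.card K p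
  have := Fact.mk hp
  have hQ : (X + C α : K[X]) ^ Fintype.card K = X ^ Fintype.card K + C α := by
    conv_rhs => rw [← FiniteField.pow_card α]
    rw [hn, add_pow_char_pow, C_pow]
  rw [taylor_X_pow, taylor_C, mul_comm j, pow_mul, hQ, C_pow]
  refine Dvd.dvd.trans ?_ (sub_dvd_pow_sub_pow _ _ j)
  rw [add_sub_cancel_right]
  exact pow_dvd_pow _ hl

lemma sub_pow_dvd_iff_hasseDeriv {K : Type*} [Field K] (α : K) (l : ℕ) (r : K[X]) :
    (X - C α) ^ l ∣ r ↔ X ^ l ∣ taylor α r := by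
  have h : taylor α ((X - C α) ^ l) = X ^ l := by simp
  constructor
  · rintro ⟨u, rfl⟩
    rw [taylor_mul, h]; exact dvd_mul_right _ _
  · rintro ⟨u, hu⟩
    refine ⟨taylor (-α) u, taylor_injective α ?_⟩
    rw [taylor_mul, h, hu, taylor_taylor]; simp

lemma sum_X_pow_mul_pow_ne_zero {K : Type*} [Field K] {ι : Type*} [Fintype ι]
    (e b : ι → ℕ) (he : Function.Injective e) (g : K[X]) (hg : g.eval 0 ≠ 0)
    (v : ι → K) (hv : v ≠ 0) : ∑ i, C (v i) * (X ^ e i * g ^ b i) ≠ 0 := by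
  classical
  obtain ⟨i₁, hi₁⟩ := Function.ne_iff.mp hv
  obtain ⟨i₀, hi₀, hmin⟩ := exists_min_image (univ.filter fun i => v i ≠ 0) e ⟨i₁, by simpa using hi₁⟩
  intro h
  have h1 := congrArg (fun q => coeff q (e i₀)) h
  simp only [finsetSum_coeff, coeff_C_mul, coeff_zero] at h1
  rw [sum_eq_single i₀] at h1
  · rw [coeff_X_pow_mul', if_pos le_rfl, Nat.sub_self, coeff_zero_eq_eval_zero, eval_pow] at h1
    exact mul_ne_zero (by simpa using hi₀) (pow_ne_zero _ hg) h1
  · intro i _ hi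
    by_cases hvi : v i = 0
    · simp [hvi]
    · have : e i₀ < e i := lt_of_le_of_ne (hmin i (by simpa using hvi)) fun h => hi (he h.symm)
      rw [coeff_X_pow_mul', if_neg (by lia), mul_zero]
  · simp

/-- Stepanov's method: the number of `α` with `f α` in a given coset of `d`-th powers. -/
theorem stepanov_card_le {K : Type*} [Field K] [Fintype K] [DecidableEq K] (f g : K[X])
    (hf : f = X * g) (hg : g.eval 0 ≠ 0) (c d l J k : ℕ) (hk : f.natDegree ≤ k)
    (hdc : d * c = Fintype.card K - 1) (hl : l ≤ Fintype.card K)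
    (hJ : l * (c + l * k + J) < J * d * c) (a : K) :
    l * #{α : K | f.eval α ≠ 0 ∧ f.eval α ^ c = a} ≤
      l * k + c + d * c * k + J * Fintype.card K := by
  set Q := Fintype.card K with hQ
  have hQ1 : 1 < Q := Fintype.one_lt_card
  have hc0 : 0 < c := Nat.pos_of_ne_zero fun h => by rw [h, mul_zero] at hdc; omega
  have hf0 : f ≠ 0 := by
    rw [hf]; exact mul_ne_zero X_ne_zero fun h => hg (by simp [h])
  choose q hqd hq using fun (i t s : ℕ) => exists_hasseDeriv_mul_pow_eq f (X ^ t) (l + i * c) s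
  set W := c + l * k + J
  let ι := Fin d × Fin J × Fin c
  let κ := Fin l × Fin W
  let P : (ι → K) → ℕ → K[X] := fun v s =>
    ∑ x : ι, v x • (C (a ^ (x.1 : ℕ)) * X ^ (x.2.1 : ℕ) * q x.1 x.2.2 s)
  let T : (ι → K) →ₗ[K] (κ → K) :=
    { toFun := fun v y => (P v y.1).coeff y.2
      map_add' := by
        intro v w; ext y; simp [P, add_smul, sum_add_distrib]
      map_smul' := by
        intro r v; ext y
        simp only [P, Pi.smul_apply, smul_eq_mul, RingHom.id_apply, mul_smul, ← smul_sum,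
          coeff_smul] }
  have hker : LinearMap.ker T ≠ ⊥ := by
    apply LinearMap.ker_ne_bot_of_finrank_lt
    simp only [Module.finrank_fintype_fun_eq_card, ι, κ, Fintype.card_prod, Fintype.card_fin]
    calc _ < J * d * c := hJ
      _ = _ := by ring
  obtain ⟨v, hvT, hv⟩ := (Submodule.ne_bot_iff _).mp hker
  have hP : ∀ s < l, P v s = 0 := by
    intro s hs
    ext m
    rw [coeff_zero]
    rcases lt_or_ge m W with hm | hm
    · exact congrFun (LinearMap.mem_ker.mp hvT) (⟨s, hs⟩, ⟨m, hm⟩)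
    · apply coeff_eq_zero_of_natDegree_lt
      refine lt_of_le_of_lt (b := W - 1) ?_ (by simp only [W] at hm ⊢; omega)
      · refine natDegree_sum_le_of_forall_le _ _ fun x _ => ?_
        refine (natDegree_smul_le _ _).trans ?_
        have h1 : (q x.1 x.2.2 s).natDegree ≤ x.2.2 + s * k := by
          refine (hqd _ _ _).trans ?_
          rw [natDegree_X_pow]; gcongr
        have h2 : (C (a ^ (x.1 : ℕ)) * X ^ (x.2.1 : ℕ) : K[X]).natDegree ≤ x.2.1 :=
          natDegree_C_mul_X_pow_le _ _
        have h3 := x.2.2.2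
        have h4 := x.2.1.2
        have h5 : s * k ≤ l * k := by gcongr
        refine natDegree_mul_le.trans ?_
        simp only [W]
        lia
  let r : K[X] := ∑ x : ι, C (v x) * (X ^ ((x.2.1 : ℕ) * Q) * (X ^ (x.2.2 : ℕ) * f ^ (l + x.1 * c)))
  have hr : r ≠ 0 := by
    have : r = f ^ l * ∑ x : ι, C (v x) *
        (X ^ ((x.2.1 : ℕ) * Q + (x.2.2 + x.1 * c)) * g ^ ((x.1 : ℕ) * c)) := by
      simp only [r, mul_sum]
      refine sum_congr rfl fun x _ => ?_
      rw [pow_add f, pow_mul f x.1 c]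
      conv_lhs => rw [← pow_mul, hf]
      conv_rhs => rw [hf]
      rw [mul_pow, mul_pow, pow_add, pow_add]; ring
    rw [this]
    refine mul_ne_zero (pow_ne_zero _ hf0) (sum_X_pow_mul_pow_ne_zero _ _ ?_ g hg v hv)
    rintro ⟨i, j, t⟩ ⟨i', j', t'⟩ h
    simp only at h
    have key : ∀ (i : Fin d) (t : Fin c), (t : ℕ) + i * c < Q := by
      intro i t
      have : ((i : ℕ) + 1) * c ≤ d * c := by gcongr; exact i.2
      have := t.2
      lia
    have hc : 0 < c := t.pos
    rw [add_comm, add_comm (_ * Q)] at h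
    have h1 := congrArg (· / Q) h
    have h2 := congrArg (· % Q) h
    simp only [Nat.mod_eq_of_lt (key _ _), Nat.add_mul_div_right _ _ (zero_lt_one.trans hQ1),
      Nat.div_eq_of_lt (key _ _), Nat.add_mul_mod_self_right, zero_add] at h1 h2
    have h3 := congrArg (· / c) h2
    have h4 := congrArg (· % c) h2
    simp only [Nat.add_mul_div_right _ _ hc, Nat.div_eq_of_lt (Fin.is_lt _),
      Nat.add_mul_mod_self_right, Nat.mod_eq_of_lt (Fin.is_lt _), zero_add] at h3 h4
    exact Prod.ext (Fin.ext h3) (Prod.ext (Fin.ext h1) (Fin.ext h4))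
  have hdvd : ∀ α : K, f.eval α ≠ 0 ∧ f.eval α ^ c = a → (X - C α) ^ l ∣ r := by
    rintro α ⟨-, hα⟩
    rw [sub_pow_dvd_iff_hasseDeriv]
    let r' : K[X] := ∑ x : ι, C (v x) * (C (α ^ (x.2.1 : ℕ)) *
      (X ^ (x.2.2 : ℕ) * f ^ (l + x.1 * c)))
    have h1 : X ^ l ∣ taylor α r - taylor α r' := by
      simp only [r, r', map_sum, ← sum_sub_distrib]
      refine dvd_sum fun x _ => ?_
      rw [taylor_mul, taylor_mul, taylor_mul _ (C (v x)), taylor_mul _ (C (α ^ (x.2.1 : ℕ))),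
        ← mul_sub, ← sub_mul]
      exact Dvd.dvd.mul_left (Dvd.dvd.mul_right (X_pow_dvd_taylor_sub α _ l hl) _) _
    have h2 : X ^ l ∣ taylor α r' := by
      rw [X_pow_dvd_iff]
      intro s hs
      rw [taylor_coeff]
      have h3 : hasseDeriv s r' = ∑ x : ι, C (v x * α ^ (x.2.1 : ℕ)) *
          (f ^ (l + x.1 * c - s) * q x.1 x.2.2 s) := by
        simp only [r', map_sum]
        refine sum_congr rfl fun x _ => ?_
        rw [← hq, ← mul_assoc, ← C_mul, ← smul_eq_C_mul, ← smul_eq_C_mul, map_smul]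
      have h4 : (P v s).eval α = 0 := by rw [hP s hs, eval_zero]
      rw [h3]
      simp only [P, eval_finsetSum, eval_smul, eval_mul, eval_C, eval_pow, eval_X] at h4 ⊢
      calc _ = f.eval α ^ (l - s) * ∑ x : ι, v x • (a ^ (x.1 : ℕ) * α ^ (x.2.1 : ℕ) *
            (q x.1 x.2.2 s).eval α) := by
            rw [mul_sum]
            refine sum_congr rfl fun x _ => ?_
            rw [show l + (x.1 : ℕ) * c - s = (l - s) + c * x.1 by rw [mul_comm c, Nat.sub_add_comm hs.le], pow_add,
              pow_mul, hα, smul_eq_mul]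
            ring
        _ = 0 := by rw [h4, mul_zero]
    simpa using dvd_add h1 h2
  have hprod : ∏ α ∈ ({α : K | f.eval α ≠ 0 ∧ f.eval α ^ c = a} : Finset K), (X - C α) ^ l ∣ r := by
    refine Finset.prod_dvd_of_coprime ?_ fun α hα => hdvd α (by simpa using hα)
    intro α _ β _ hab
    exact (isCoprime_X_sub_C_of_isUnit_sub (sub_ne_zero.mpr hab).isUnit).pow
  have hdeg := natDegree_le_of_dvd hprod hr
  rw [natDegree_prod _ _ fun α _ => pow_ne_zero _ (X_sub_C_ne_zero α)] at hdeg
  simp only [natDegree_pow, natDegree_X_sub_C, mul_one, sum_const, smul_eq_mul] at hdeg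
  rw [mul_comm]
  refine hdeg.trans (natDegree_sum_le_of_forall_le _ _ fun x _ => ?_)
  refine (natDegree_C_mul_le _ _).trans ?_
  refine natDegree_mul_le.trans ?_
  rw [natDegree_X_pow]
  have h1 : (X ^ (x.2.2 : ℕ) * f ^ (l + x.1 * c)).natDegree ≤ x.2.2 + (l + x.1 * c) * k := by
    refine natDegree_mul_le.trans ?_
    rw [natDegree_X_pow]
    gcongr
    exact natDegree_pow_le.trans (by gcongr)
  have h2 := x.2.2.2.le
  have h3 : (x.2.1 : ℕ) * Q ≤ J * Q := by gcongr; exact x.2.1.2.le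
  have h4 : (x.1 : ℕ) * c * k ≤ d * c * k := by gcongr; exact x.1.2.le
  rw [add_mul] at h1
  lia

end Stepanov

section StepanovCharSum

open Polynomial Finset

lemma norm_sum_mul_natCast_le {t : Type*} (s : Finset t) (w : t → ℂ) (hw : ∑ i ∈ s, w i = 0)
    (hw1 : ∀ i ∈ s, ‖w i‖ ≤ 1) (n : t → ℕ) (B : ℝ) (hB : ∀ i ∈ s, (n i : ℝ) ≤ B) :
    ‖∑ i ∈ s, w i * n i‖ ≤ #s * B - ∑ i ∈ s, (n i : ℝ) := by
  have h : ∑ i ∈ s, w i * n i = - ∑ i ∈ s, w i * ((B - n i : ℝ) : ℂ) := by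
    push_cast
    simp_rw [mul_sub, sum_sub_distrib, ← sum_mul, hw]
    ring
  rw [h, norm_neg]
  calc _ ≤ ∑ i ∈ s, ‖w i * ((B - n i : ℝ) : ℂ)‖ := norm_sum_le _ _
    _ ≤ ∑ i ∈ s, (B - n i) := by
        refine sum_le_sum fun i hi => ?_
        rw [norm_mul, Complex.norm_real, Real.norm_eq_abs, abs_of_nonneg (sub_nonneg.mpr (hB i hi))]
        exact mul_le_of_le_one_left (sub_nonneg.mpr (hB i hi)) (hw1 i hi)
    _ = _ := by rw [sum_sub_distrib, sum_const, nsmul_eq_mul]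

/-- Equidistribution bounds for the fibres of `f α ^ c` bound the character sum. -/
lemma norm_sum_mulChar_eval_le {K : Type*} [Field K] [Fintype K] [DecidableEq K] (f : K[X])
    (hf0 : f ≠ 0) (k : ℕ) (hk : f.natDegree ≤ k) (c d : ℕ) (hd : 0 < d)
    (hdc : d * c = Fintype.card K - 1) (ψ : MulChar K ℂ) (hψ : ψ ≠ 1) (hψd : ψ ^ d = 1) (B : ℝ)
    (hB : ∀ a : K, (#{α : K | f.eval α ≠ 0 ∧ f.eval α ^ c = a} : ℝ) ≤ B) :
    ‖∑ α : K, ψ (f.eval α)‖ ≤ d * B - Fintype.card K + k := by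
  have hQ1 : 1 < Fintype.card K := Fintype.one_lt_card
  obtain ⟨g, hg⟩ := IsCyclic.exists_generator (α := Kˣ)
  have hordg : orderOf g = d * c := by
    rw [orderOf_eq_card_of_forall_mem_zpowers hg, Nat.card_eq_fintype_card, Fintype.card_units, hdc]
  have hdc0 : 0 < d * c := by omega
  have hc0 : 0 < c := Nat.pos_of_mul_pos_left hdc0
  set w : ℂ := ψ g with hw
  have hwd : w ^ d = 1 := by
    rw [hw, ← MulChar.pow_apply_coe, hψd, MulChar.one_apply_coe]
  have hw1 : w ≠ 1 := by
    intro h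
    apply hψ
    ext u
    obtain ⟨s, hs⟩ := (Submonoid.mem_powers_iff _ _).mp ((mem_powers_iff_mem_zpowers (x := g)).mpr (hg u))
    rw [← hs, Units.val_pow_eq_pow_val, map_pow, ← hw, h, one_pow, MulChar.one_apply]
    exact (Units.isUnit g).pow s
  have hwsum : ∑ t ∈ range d, w ^ t = 0 := by
    have := geom_sum_mul w d
    rw [hwd, sub_self] at this
    exact (mul_eq_zero.mp this).resolve_right (sub_ne_zero.mpr hw1)
  have hwnorm : ‖w‖ = 1 := Complex.norm_eq_one_of_pow_eq_one hwd hd.ne'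
  let S : ℕ → Finset K := fun t => {α : K | f.eval α ≠ 0 ∧ f.eval α ^ c = (g : K) ^ (c * t)}
  have hinj : ∀ t ∈ range d, ∀ t' ∈ range d, (g : K) ^ (c * t) = (g : K) ^ (c * t') → t = t' := by
    intro t ht t' ht' h
    have h1 : g ^ (c * t) = g ^ (c * t') := Units.ext (by simpa using h)
    rw [mem_range] at ht ht'
    have h2 := pow_injOn_Iio_orderOf (x := g) (x₁ := c * t) (x₂ := c * t')
      (by rw [hordg, Set.mem_Iio, mul_comm]; exact (Nat.mul_lt_mul_right hc0).mpr ht)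
      (by rw [hordg, Set.mem_Iio, mul_comm]; exact (Nat.mul_lt_mul_right hc0).mpr ht') h1
    exact Nat.eq_of_mul_eq_mul_left hc0 h2
  have hpart : ({α : K | f.eval α ≠ 0} : Finset K) = (range d).biUnion S := by
    ext α
    simp only [S, mem_filter, mem_univ, true_and, mem_biUnion]
    refine ⟨fun h => ?_, fun ⟨t, _, h, _⟩ => h⟩
    obtain ⟨s, hs⟩ := (Submonoid.mem_powers_iff _ _).mp
      ((mem_powers_iff_mem_zpowers (x := g)).mpr (hg (Units.mk0 _ h)))
    have hs' : (g : K) ^ s = f.eval α := by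
      rw [← Units.val_pow_eq_pow_val, hs, Units.val_mk0]
    refine ⟨s % d, mem_range.mpr (Nat.mod_lt _ hd), h, ?_⟩
    have h1 : g ^ (s * c) = g ^ (c * (s % d)) := by
      rw [pow_eq_pow_iff_modEq, hordg, mul_comm s c, mul_comm d c]
      exact (Nat.ModEq.mul_left' c (Nat.mod_modEq s d)).symm
    rw [← hs', ← pow_mul]
    exact_mod_cast congrArg Units.val h1
  have hdisj : Set.PairwiseDisjoint (↑(range d)) S := by
    intro t ht t' ht' htt'
    rw [Function.onFun, disjoint_left]
    intro α h1 h2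
    simp only [S, mem_filter] at h1 h2
    exact htt' (hinj t ht t' ht' (h1.2.2.symm.trans h2.2.2))
  have hval : ∀ t ∈ range d, ∀ α ∈ S t, ψ (f.eval α) = w ^ t := by
    intro t ht α hα
    simp only [S, mem_filter, mem_univ, true_and] at hα
    obtain ⟨s, hs⟩ := (Submonoid.mem_powers_iff _ _).mp
      ((mem_powers_iff_mem_zpowers (x := g)).mpr (hg (Units.mk0 _ hα.1)))
    have hs' : (g : K) ^ s = f.eval α := by
      rw [← Units.val_pow_eq_pow_val, hs, Units.val_mk0]
    have h1 : g ^ (c * s) = g ^ (c * t) := Units.ext (by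
      rw [mul_comm c s]
      simpa [← hs', ← pow_mul] using hα.2)
    rw [pow_eq_pow_iff_modEq, hordg, mul_comm d c] at h1
    have h2 : s ≡ t [MOD d] := Nat.ModEq.mul_left_cancel' hc0.ne' h1
    rw [← hs', map_pow, ← hw]
    exact pow_eq_pow_of_modEq h2 hwd
  have hsum : ∑ α : K, ψ (f.eval α) = ∑ t ∈ range d, w ^ t * (#(S t) : ℕ) := by
    calc _ = ∑ α ∈ ({α : K | f.eval α ≠ 0} : Finset K), ψ (f.eval α) := by
          rw [sum_filter]
          refine sum_congr rfl fun α _ => ?_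
          split_ifs with h
          · rfl
          · rw [not_not.mp h, MulChar.map_zero]
      _ = _ := by
          rw [hpart, sum_biUnion hdisj]
          refine sum_congr rfl fun t ht => ?_
          rw [sum_congr rfl (hval t ht), sum_const, nsmul_eq_mul, mul_comm]
  have hcard : (Fintype.card K : ℝ) - k ≤ ∑ t ∈ range d, (#(S t) : ℝ) := by
    have h1 : #({α : K | f.eval α ≠ 0} : Finset K) = ∑ t ∈ range d, #(S t) := by
      rw [hpart, card_biUnion fun t ht t' ht' h => hdisj ht ht' h]
    have h2 : #({α : K | ¬ f.eval α ≠ 0} : Finset K) ≤ k := by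
      refine le_trans ?_ hk
      refine le_trans (card_le_card (t := f.roots.toFinset) fun α hα => ?_)
        ((Multiset.toFinset_card_le _).trans (card_roots' f))
      rw [mem_filter, not_not] at hα
      rw [Multiset.mem_toFinset, mem_roots hf0]
      exact hα.2
    have h3 := card_filter_add_card_filter_not (s := (univ : Finset K)) (fun α => f.eval α ≠ 0)
    rw [card_univ] at h3
    have : Fintype.card K ≤ ∑ t ∈ range d, #(S t) + k := by omega
    have : (Fintype.card K : ℝ) ≤ ∑ t ∈ range d, (#(S t) : ℝ) + k := by exact_mod_cast this
    linarith
  rw [hsum]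
  have := norm_sum_mul_natCast_le (range d) (fun t => w ^ t) hwsum
    (fun t _ => by rw [norm_pow, hwnorm, one_pow]) (fun t => #(S t)) B (fun t _ => hB _)
  rw [card_range] at this
  linarith

theorem norm_sum_mulChar_eval_le_sqrt {K : Type*} [Field K] [Fintype K] [DecidableEq K]
    (f g : K[X]) (hf : f = X * g) (hg : g.eval 0 ≠ 0) (k : ℕ) (hk : f.natDegree ≤ k) (d : ℕ)
    (hd : 0 < d) (hdQ : d ∣ Fintype.card K - 1) (hQ9 : 9 ≤ Fintype.card K) (ψ : MulChar K ℂ)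
    (hψ : ψ ≠ 1) (hψd : ψ ^ d = 1) :
    ‖∑ α : K, ψ (f.eval α)‖ ≤ (d * (7 * k + 10) + k : ℕ) * √(Fintype.card K) := by
  obtain ⟨c, hc⟩ := hdQ
  have hf0 : f ≠ 0 := by
    rw [hf]; exact mul_ne_zero X_ne_zero fun h => hg (by simp [h])
  set Q := Fintype.card K with hQ
  set l := Nat.sqrt Q with hl
  have hl2 : l * l ≤ Q := Nat.sqrt_le Q
  have hl3 : 3 ≤ l := Nat.le_sqrt.mpr (by omega)
  have hl4 : Q < (l + 1) * (l + 1) := Nat.lt_succ_sqrt Q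
  have hc0 : 0 < c := Nat.pos_of_ne_zero fun h => by rw [h, mul_zero] at hc; omega
  set M := 2 * k + 4 with hM
  have hJd : l + 1 + M * d ≤ (l / d + M) * d + d := by
    have := Nat.lt_div_mul_add (a := l) hd
    rw [add_mul (l / d)]; omega
  have hld : l * (l / d) ≤ l * l := by gcongr; exact Nat.div_le_self _ _
  have hJ : l * (c + l * k + (l / d + M)) < (l / d + M) * d * c := by
    have h1 : (l + 1 + M * d) * c ≤ (l / d + M) * d * c + (Q - 1) := by
      rw [hc, ← add_mul]; gcongr
    have h2 : (l + 1 + M * d) * c = l * c + c + M * (Q - 1) := by rw [hc]; ring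
    obtain ⟨Q', hQ'⟩ : ∃ Q', Q = Q' + 1 := ⟨Q - 1, by omega⟩
    rw [hQ', Nat.add_sub_cancel] at h1 h2
    have h3 : l * (c + l * k + (l / d + M)) = l * c + l * l * k + l * (l / d) + l * M := by ring
    have h4 : l * l * k ≤ Q * k := by gcongr
    have h5 : 3 * (l * M) ≤ Q * M := by
      calc 3 * (l * M) ≤ l * (l * M) := by gcongr
        _ = l * l * M := by ring
        _ ≤ _ := by gcongr
    rw [hQ'] at h4 h5
    have h6 : (Q' + 1) * k = Q' * k + k := by ring
    have h7 : (Q' + 1) * M = 2 * (Q' * k) + 4 * Q' + 2 * k + 4 := by rw [hM]; ring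
    have h8 : M * Q' = 2 * (Q' * k) + 4 * Q' := by rw [hM]; ring
    have h9 : 8 * k ≤ Q' * k := by gcongr; omega
    rw [h3]
    rw [h7] at h5
    rw [h6] at h4
    omega
  have hB : ∀ a : K, (#{α : K | f.eval α ≠ 0 ∧ f.eval α ^ c = a} : ℝ) ≤
      Q / d + (7 * k + 10) * √Q := by
    intro a
    have h1 := stepanov_card_le f g hf hg c d l (l / d + M) k hk hc.symm
      ((Nat.le_mul_self l).trans hl2) hJ a
    set N := #{α : K | f.eval α ≠ 0 ∧ f.eval α ^ c = a}
    have hs0 : (√Q : ℝ) ^ 2 = Q := Real.sq_sqrt (Nat.cast_nonneg _)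
    have hl' : (3 : ℝ) ≤ l := by exact_mod_cast hl3
    have hsl : √(Q : ℝ) ≤ 2 * l := by
      rw [Real.sqrt_le_left (by positivity)]
      have : (Q : ℝ) < (l + 1) * (l + 1) := by exact_mod_cast hl4
      nlinarith
    have hls : (l : ℝ) ≤ √Q := Real.le_sqrt_of_sq_le (by exact_mod_cast (sq l ▸ hl2))
    have hdpos : (0 : ℝ) < d := by exact_mod_cast hd
    have hcQ : (d : ℝ) * c ≤ Q := by exact_mod_cast (by omega : d * c ≤ Q)
    have hcQ' : (c : ℝ) ≤ Q := by
      exact_mod_cast (Nat.le_mul_of_pos_left c hd).trans (by omega : d * c ≤ Q)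
    have hldr : ((l / d : ℕ) : ℝ) ≤ l / d := Nat.cast_div_le
    have h2 : (l : ℝ) * N ≤ l * k + c + d * c * k + ((l / d : ℕ) + M) * Q := by exact_mod_cast h1
    have h3 : (l : ℝ) * N ≤ l * (Q / d + (7 * k + 10) * √Q) := by
      have hM' : (M : ℝ) = 2 * k + 4 := by rw [hM]; push_cast; ring
      have hk0 : (0 : ℝ) ≤ k := Nat.cast_nonneg k
      have e1 : ((l / d : ℕ) : ℝ) * Q ≤ l * (Q / d) := by
        calc _ ≤ (l : ℝ) / d * Q := by gcongr
          _ = _ := by ring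
      have e2 : (Q : ℝ) ≤ 2 * (l * √Q) := by nlinarith [Real.sqrt_nonneg (Q : ℝ)]
      have e3 : (d : ℝ) * c * k ≤ Q * k := by gcongr
      have e4 : (l : ℝ) * k ≤ l * √Q * k := by
        have : (1 : ℝ) ≤ √Q := by linarith
        have : (l : ℝ) * 1 ≤ l * √Q := by gcongr
        nlinarith
      have e5 : (Q : ℝ) * k ≤ 2 * (l * √Q) * k := by gcongr
      rw [hM'] at h2
      nlinarith
    exact le_of_mul_le_mul_left h3 (by linarith)
  have hdpos : (0 : ℝ) < d := by exact_mod_cast hd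
  refine (norm_sum_mulChar_eval_le f hf0 k hk c d hd hc.symm ψ hψ hψd _ hB).trans ?_
  rw [← hQ, mul_add, mul_div_cancel₀ _ hdpos.ne']
  have hs1 : (1 : ℝ) ≤ √Q := Real.one_le_sqrt.mpr (by exact_mod_cast (by omega : 1 ≤ Q))
  have : (k : ℝ) ≤ k * √Q := le_mul_of_one_le_right (Nat.cast_nonneg _) hs1
  push_cast
  nlinarith

end StepanovCharSum

section MonicPolynomials

open Polynomial Finset UniqueFactorizationMonoid

variable (F : Type*) [Field F] [Fintype F]

lemma finite_monic_natDegree_eq (n : ℕ) : {h : F[X] | h.Monic ∧ h.natDegree = n}.Finite := by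
  refine Set.Finite.of_injOn (f := fun h : F[X] => fun i : Fin n => h.coeff i)
    (t := Set.univ) (fun _ _ => Set.mem_univ _) ?_ Set.finite_univ
  rintro a ⟨ha, han⟩ b ⟨hb, hbn⟩ hab
  ext i
  rcases lt_trichotomy i n with h | h | h
  · exact congrFun hab ⟨i, h⟩
  · rw [h]
    nth_rewrite 1 [← han]
    rw [ha.coeff_natDegree, ← hbn, hb.coeff_natDegree]
  · rw [coeff_eq_zero_of_natDegree_lt (by omega), coeff_eq_zero_of_natDegree_lt (by omega)]

/-- The monic polynomials of degree `n` over a finite field. -/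
noncomputable def monicOfDegree (n : ℕ) : Finset F[X] := (finite_monic_natDegree_eq F n).toFinset

variable {F}

@[simp] lemma mem_monicOfDegree {n : ℕ} {h : F[X]} :
    h ∈ monicOfDegree F n ↔ h.Monic ∧ h.natDegree = n := by
  simp [monicOfDegree]

variable (F) in
open Classical in
/-- The monic irreducible polynomials of degree `n` over a finite field. -/
noncomputable def irredOfDegree (n : ℕ) : Finset F[X] := {h ∈ monicOfDegree F n | Irreducible h}

@[simp] lemma mem_irredOfDegree {n : ℕ} {h : F[X]} :
    h ∈ irredOfDegree F n ↔ (h.Monic ∧ h.natDegree = n) ∧ Irreducible h := by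
  simp [irredOfDegree]

open Classical in
lemma sum_natDegree_irredOfDegree {N : ℕ} {h : F[X]} (hh : h ∈ monicOfDegree F N) :
    N = ∑ d ∈ Icc 1 N, ∑ P ∈ irredOfDegree F d, ∑ r ∈ Icc 1 N, if P ^ r ∣ h then d else 0 := by
  obtain ⟨hm, hN⟩ := mem_monicOfDegree.mp hh
  have h0 := hm.ne_zero
  have hmonic : ∀ f ∈ normalizedFactors h, f.Monic := fun f hf =>
    (normalize_normalized_factor f hf) ▸ monic_normalize (ne_zero_of_mem_normalizedFactors hf)
  have hprod : (normalizedFactors h).prod = h := by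
    rw [prod_normalizedFactors_eq h0, hm.normalize_eq_self]
  have hdeg : N = ∑ P ∈ (normalizedFactors h).toFinset,
      (normalizedFactors h).count P * P.natDegree := by
    rw [← hN]
    conv_lhs => rw [← hprod, natDegree_multiset_prod_of_monic _ hmonic, sum_multiset_map_count]
    simp
  have hpd : ∀ P ∈ normalizedFactors h, P ∣ h := fun P hP => dvd_of_mem_normalizedFactors hP
  have hcount : ∀ d, ∀ P ∈ irredOfDegree F d,
      ∑ r ∈ Icc 1 N, (if P ^ r ∣ h then d else 0) =
      (normalizedFactors h).count P * P.natDegree := by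
    intro d P hP
    obtain ⟨⟨hPm, hPd⟩, hPi⟩ := mem_irredOfDegree.mp hP
    have hiff : ∀ r, P ^ r ∣ h ↔ r ≤ (normalizedFactors h).count P := by
      intro r
      rw [pow_dvd_iff_le_emultiplicity, emultiplicity_eq_count_normalizedFactors hPi h0,
        hPm.normalize_eq_self, Nat.cast_le]
    have hpos : 0 < P.natDegree := hPi.natDegree_pos
    have hle : (normalizedFactors h).count P ≤ N := by
      have := natDegree_le_of_dvd ((hiff _).mpr le_rfl) h0
      rw [natDegree_pow, hN] at this
      nlinarith
    rw [← sum_filter, sum_const, smul_eq_mul, hPd]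
    congr 1
    have : {r ∈ Icc 1 N | P ^ r ∣ h} = Icc 1 ((normalizedFactors h).count P) := by
      ext r
      simp only [mem_filter, mem_Icc, hiff]
      omega
    rw [this, Nat.card_Icc]
    omega
  rw [sum_congr rfl fun d _ => sum_congr rfl (hcount d)]
  rw [← sum_biUnion]
  · rw [hdeg]
    refine sum_subset ?_ ?_
    · intro P hP
      rw [Multiset.mem_toFinset] at hP
      rw [← hdeg, mem_biUnion]
      have hPi := irreducible_of_normalized_factor P hP
      refine ⟨P.natDegree, ?_, by simpa using ⟨hmonic P hP, hPi⟩⟩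
      rw [mem_Icc]
      exact ⟨hPi.natDegree_pos, hN ▸ natDegree_le_of_dvd (hpd P hP) h0⟩
    · intro P _ hP
      rw [Multiset.mem_toFinset] at hP
      rw [Multiset.count_eq_zero.mpr hP, zero_mul]
  · intro a _ b _ hab
    refine Finset.disjoint_left.mpr fun P hPa hPb => hab ?_
    rw [← (mem_irredOfDegree.mp hPa).1.2, ← (mem_irredOfDegree.mp hPb).1.2]

open Classical in
lemma sum_monicOfDegree_dvd (X : F[X] →* ℂ) {N d r : ℕ} {P : F[X]} (hP : P ∈ irredOfDegree F d) :
    ∑ h ∈ monicOfDegree F N with P ^ r ∣ h, X h =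
      if r * d ≤ N then X P ^ r * ∑ h ∈ monicOfDegree F (N - r * d), X h else 0 := by
  obtain ⟨⟨hPm, hPd⟩, hPi⟩ := mem_irredOfDegree.mp hP
  split_ifs with hle
  · rw [mul_sum]
    symm
    refine sum_bij (fun h _ => P ^ r * h) ?_ ?_ ?_ ?_
    · intro h hh
      obtain ⟨hm, hN⟩ := mem_monicOfDegree.mp hh
      rw [mem_filter, mem_monicOfDegree]
      refine ⟨⟨(hPm.pow r).mul hm, ?_⟩, dvd_mul_right _ _⟩
      rw [(hPm.pow r).natDegree_mul hm, natDegree_pow, hPd, hN]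
      omega
    · intro a _ b _ hab
      exact mul_left_cancel₀ (hPm.pow r).ne_zero hab
    · intro b hb
      rw [mem_filter, mem_monicOfDegree] at hb
      obtain ⟨⟨hm, hN⟩, h, rfl⟩ := hb
      have hm' := (hPm.pow r).of_mul_monic_left hm
      refine ⟨h, ?_, rfl⟩
      rw [(hPm.pow r).natDegree_mul hm', natDegree_pow, hPd] at hN
      rw [mem_monicOfDegree]
      exact ⟨hm', by omega⟩
    · intro h _
      rw [map_mul, map_pow]
  · rw [Finset.filter_eq_empty_iff.mpr, sum_empty]
    intro h hh hdvd
    obtain ⟨hm, hN⟩ := mem_monicOfDegree.mp hh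
    have := natDegree_le_of_dvd hdvd hm.ne_zero
    rw [natDegree_pow, hPd, hN] at this
    exact hle this

/-- The Newton-type identity encoding the Euler product of a multiplicative function on
`F[X]`. -/
lemma natCast_mul_sum_monicOfDegree (X : F[X] →* ℂ) (N : ℕ) :
    N * ∑ h ∈ monicOfDegree F N, X h =
      ∑ n ∈ Icc 1 N, (∑ d ∈ n.divisors, d * ∑ P ∈ irredOfDegree F d, X P ^ (n / d)) *
        ∑ h ∈ monicOfDegree F (N - n), X h := by
  classical
  have h1 : N * ∑ h ∈ monicOfDegree F N, X h = ∑ d ∈ Icc 1 N, ∑ P ∈ irredOfDegree F d,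
      ∑ r ∈ Icc 1 N, d * (if r * d ≤ N then
        X P ^ r * ∑ h ∈ monicOfDegree F (N - r * d), X h else 0) := by
    calc _ = ∑ h ∈ monicOfDegree F N, ∑ d ∈ Icc 1 N, ∑ P ∈ irredOfDegree F d,
          ∑ r ∈ Icc 1 N, (d : ℂ) * if P ^ r ∣ h then X h else 0 := by
          rw [mul_sum]
          refine sum_congr rfl fun h hh => ?_
          conv_lhs => rw [sum_natDegree_irredOfDegree hh]
          push_cast
          simp_rw [sum_mul]
          refine sum_congr rfl fun d _ => sum_congr rfl fun P _ => sum_congr rfl fun r _ => ?_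
          split_ifs <;> simp
      _ = _ := by
          rw [sum_comm]
          refine sum_congr rfl fun d _ => ?_
          rw [sum_comm]
          refine sum_congr rfl fun P hP => ?_
          rw [sum_comm]
          refine sum_congr rfl fun r _ => ?_
          rw [← mul_sum, ← sum_monicOfDegree_dvd X hP, sum_filter]
  have h2 : ∀ n ∈ Icc 1 N, (∑ d ∈ n.divisors, d * ∑ P ∈ irredOfDegree F d, X P ^ (n / d)) *
        ∑ h ∈ monicOfDegree F (N - n), X h = ∑ d ∈ Icc 1 N, if d ∣ n then
        ∑ P ∈ irredOfDegree F d, d * (X P ^ (n / d) * ∑ h ∈ monicOfDegree F (N - n), X h)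
          else 0 := by
    intro n hn
    rw [mem_Icc] at hn
    rw [Finset.sum_mul _ _ (∑ h ∈ monicOfDegree F (N - n), X h), ← sum_filter]
    have : n.divisors = {d ∈ Icc 1 N | d ∣ n} := by
      ext d
      simp only [Nat.mem_divisors, mem_filter, mem_Icc]
      constructor
      · rintro ⟨h, h0⟩
        have := Nat.le_of_dvd (by omega) h
        have := Nat.pos_of_dvd_of_pos h (by omega)
        omega
      · rintro ⟨h, h0⟩
        exact ⟨h0, by omega⟩
    rw [this]
    refine sum_congr rfl fun d _ => ?_
    rw [← mul_sum, mul_assoc, sum_mul]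
  rw [h1, sum_congr rfl h2, sum_comm]
  refine sum_congr rfl fun d hd => ?_
  rw [mem_Icc] at hd
  rw [← sum_filter]
  rw [sum_comm]
  simp_rw [mul_ite, mul_zero]
  have h3 : ∀ r, (∑ P ∈ irredOfDegree F d, if r * d ≤ N then
      (d : ℂ) * (X P ^ r * ∑ h ∈ monicOfDegree F (N - r * d), X h) else 0) = if r * d ≤ N then
      ∑ P ∈ irredOfDegree F d, (d : ℂ) * (X P ^ r * ∑ h ∈ monicOfDegree F (N - r * d), X h)
        else 0 := by
    intro r
    split_ifs <;> simp
  simp_rw [h3]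
  rw [← sum_filter]
  refine sum_nbij' (fun r => r * d) (fun n => n / d) ?_ ?_ ?_ ?_ ?_
  · intro r hr
    simp only [mem_filter, mem_Icc] at hr ⊢
    exact ⟨⟨Nat.mul_pos (by omega) (by omega), hr.2⟩, dvd_mul_left _ _⟩
  · intro n hn
    simp only [mem_filter, mem_Icc] at hn ⊢
    obtain ⟨⟨h1, h2⟩, r, rfl⟩ := hn
    rw [Nat.mul_div_cancel_left _ (by omega)]
    exact ⟨⟨Nat.pos_of_ne_zero (by rintro rfl; simp at h1), by nlinarith⟩, by rwa [mul_comm]⟩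
  · intro r hr
    exact Nat.mul_div_cancel _ (by omega)
  · intro n hn
    simp only [mem_filter] at hn
    exact Nat.div_mul_cancel hn.2
  · intro r hr
    simp only [Nat.mul_div_cancel _ (show 0 < d by omega)]

end MonicPolynomials

section ExtensionSums

open Polynomial Finset Module IntermediateField

lemma norm_algebraMap_sub_eq_pow {F K : Type*} [Field F] [Field K] [Algebra F K]
    [FiniteDimensional F K] (a : F) (α : K) :
    Algebra.norm F (algebraMap F K a - α) =
      ((minpoly F α).eval a) ^ (finrank F K / (minpoly F α).natDegree) := by
  set β := α - algebraMap F K a with hβ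
  have hαi : IsIntegral F α := Algebra.IsIntegral.isIntegral α
  have hβi : IsIntegral F β := Algebra.IsIntegral.isIntegral β
  have hmin : minpoly F β = (minpoly F α).comp (X + C a) := minpoly.sub_algebraMap α a
  have hdeg : (minpoly F β).natDegree = (minpoly F α).natDegree := by
    rw [hmin, natDegree_comp, natDegree_X_add_C, mul_one]
  have hcoeff : (minpoly F β).coeff 0 = (minpoly F α).eval a := by
    rw [hmin, coeff_zero_eq_eval_zero, eval_comp]; simp
  have hfin : (minpoly F β).natDegree * finrank F⟮β⟯ K = finrank F K := by
    rw [← adjoin.finrank hβi, finrank_mul_finrank]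
  have hpos : 0 < (minpoly F β).natDegree := minpoly.natDegree_pos hβi
  have hnorm : Algebra.norm F β =
      ((-1) ^ (minpoly F β).natDegree * (minpoly F β).coeff 0) ^ finrank F⟮β⟯ K := by
    rw [Algebra.norm_eq_norm_adjoin, ← adjoin.powerBasis_gen hβi,
      Algebra.PowerBasis.norm_gen_eq_coeff_zero_minpoly, adjoin.powerBasis_gen,
      minpoly_gen, adjoin.powerBasis_dim]
  have hneg : algebraMap F K a - α = algebraMap F K (-1) * β := by
    rw [hβ]; simp
  rw [hneg, map_mul, Algebra.norm_algebraMap, hnorm, mul_pow, ← pow_mul, hfin, ← mul_assoc,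
    ← mul_pow, neg_one_mul, neg_neg, one_pow, one_mul, hcoeff, ← hdeg, ← hfin,
    Nat.mul_div_cancel_left _ hpos]

open Classical in
lemma card_filter_minpoly_eq {F K : Type*} [Field F] [Fintype F] [Field K] [Fintype K] [Algebra F K]
    {P : F[X]} (hP : Irreducible P) (hm : P.Monic) (hd : P.natDegree ∣ finrank F K) :
    #{α : K | minpoly F α = P} = P.natDegree := by
  have hdvd : P ∣ X ^ Fintype.card K - X := by
    have := hP.natDegree_dvd_iff_dvd_X_pow_card_pow_sub_X.mp hd
    rwa [Nat.card_eq_fintype_card, ← Module.card_eq_pow_finrank] at this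
  have hs : (P.map (algebraMap F K)).Splits := by
    refine (FiniteField.isSplittingField_sub K F).splits.of_dvd ?_ ?_
    · exact map_ne_zero (FiniteField.X_pow_card_sub_X_ne_zero _ Fintype.one_lt_card)
    · exact (map_dvd_map' _).mpr hdvd
  rw [← card_rootSet_eq_natDegree (PerfectField.separable_of_irreducible hP) hs,
    ← Fintype.card_coe]
  refine Fintype.card_congr (Equiv.subtypeEquivRight fun α => ?_)
  rw [mem_filter, mem_rootSet]
  refine ⟨?_, ?_⟩
  · rintro ⟨-, rfl⟩
    exact ⟨hm.ne_zero, minpoly.aeval _ _⟩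
  · rintro ⟨-, h⟩
    exact ⟨mem_univ _, (minpoly.eq_of_irreducible_of_monic hP h hm).symm⟩

lemma sum_minpoly_eq {F K : Type*} [Field F] [Fintype F] [Field K] [Fintype K] [Algebra F K]
    (X : F[X] →* ℂ) :
    ∑ α : K, X (minpoly F α) ^ (finrank F K / (minpoly F α).natDegree) =
      ∑ d ∈ (finrank F K).divisors,
        d * ∑ P ∈ irredOfDegree F d, X P ^ (finrank F K / d) := by
  classical
  have hdvd : ∀ α : K, (minpoly F α).natDegree ∣ finrank F K := fun α => by
    have hαi : IsIntegral F α := Algebra.IsIntegral.isIntegral α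
    rw [← adjoin.finrank hαi]
    exact ⟨_, (finrank_mul_finrank F F⟮α⟯ K).symm⟩
  have h1 := sum_fiberwise_of_maps_to (s := univ) (t := (finrank F K).divisors)
    (g := fun α : K => (minpoly F α).natDegree)
    (fun α _ => Nat.mem_divisors.mpr ⟨hdvd α, finrank_pos.ne'⟩)
    (fun α : K => X (minpoly F α) ^ (finrank F K / (minpoly F α).natDegree))
  rw [← h1]
  refine sum_congr rfl fun d hd => ?_
  rw [mul_sum]
  have h2 := sum_fiberwise_of_maps_to (s := {α : K | (minpoly F α).natDegree = d})
    (t := irredOfDegree F d) (g := fun α : K => minpoly F α)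
    (fun α hα => by
      have hαi : IsIntegral F α := Algebra.IsIntegral.isIntegral α
      simp only [mem_filter, mem_univ, true_and] at hα
      exact mem_irredOfDegree.mpr ⟨⟨minpoly.monic hαi, hα⟩, minpoly.irreducible hαi⟩)
    (fun α : K => X (minpoly F α) ^ (finrank F K / (minpoly F α).natDegree))
  rw [← h2]
  refine sum_congr rfl fun P hP => ?_
  obtain ⟨⟨hPm, hPd⟩, hPi⟩ := mem_irredOfDegree.mp hP
  have h3 : {α ∈ ({α : K | (minpoly F α).natDegree = d} : Finset K) | minpoly F α = P} =
      ({α : K | minpoly F α = P} : Finset K) := by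
    ext α
    simp only [mem_filter, mem_univ, true_and, and_iff_right_iff_imp]
    rintro rfl
    exact hPd
  rw [h3, sum_congr rfl (g := fun _ => X P ^ (finrank F K / d))]
  · rw [sum_const, card_filter_minpoly_eq hPi hPm (hPd ▸ Nat.dvd_of_mem_divisors hd), hPd,
      nsmul_eq_mul]
  · intro α hα
    rw [(mem_filter.mp hα).2, hPd]

end ExtensionSums

section PowerSumBound

open Polynomial Finset Filter Topology

lemma hasSum_coeff_mul_pow (P : ℂ[X]) (T : ℂ) : HasSum (fun n => P.coeff n * T ^ n) (P.eval T) := by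
  rw [eval_eq_sum, Polynomial.sum]
  refine hasSum_sum_of_ne_finset_zero fun n hn => ?_
  rw [notMem_support_iff.mp hn, zero_mul]

lemma norm_ge_of_isRoot_of_newton {L : ℂ[X]} (h0 : L.coeff 0 = 1) {S : ℕ → ℂ} {D R : ℝ}
    (hR : 0 < R) (hS : ∀ n, ‖S n‖ ≤ D * R ^ n)
    (hN : ∀ N : ℕ, N * L.coeff N = ∑ ij ∈ antidiagonal N, L.coeff ij.1 * S ij.2)
    {z : ℂ} (hz : L.IsRoot z) : R⁻¹ ≤ ‖z‖ := by
  by_contra! hlt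
  obtain ⟨ρ, hzρ, hρ⟩ := exists_between hlt
  have hρ0 : 0 ≤ ρ := (norm_nonneg z).trans hzρ.le
  have hRρ : R * ρ < 1 := by rw [mul_comm, ← lt_div_iff₀ hR, one_div]; exact hρ
  have hRρ0 : 0 ≤ R * ρ := by positivity
  have hL0 : L ≠ 0 := by rintro rfl; simp at h0
  have hz0 : z ≠ 0 := by
    rintro rfl
    rw [IsRoot.def, ← coeff_zero_eq_eval_zero, h0] at hz
    exact one_ne_zero hz
  have hbound : ∀ T : ℂ, ‖T‖ ≤ ρ → ∀ n, ‖S n * T ^ n‖ ≤ D * (R * ρ) ^ n := by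
    intro T hT n
    rw [norm_mul, norm_pow, mul_pow, ← mul_assoc]
    exact mul_le_mul (hS n) (pow_le_pow_left₀ (norm_nonneg _) hT n) (by positivity)
      ((norm_nonneg _).trans (hS n))
  have hgeo : Summable fun n => D * (R * ρ) ^ n :=
    (summable_geometric_of_lt_one hRρ0 hRρ).mul_left D
  have hsum : ∀ T : ℂ, ‖T‖ ≤ ρ → Summable fun n => ‖S n * T ^ n‖ := fun T hT =>
    Summable.of_nonneg_of_le (fun _ => norm_nonneg _) (hbound T hT) hgeo
  set B := ∑' n, D * (R * ρ) ^ n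
  have hG : ∀ T : ℂ, ‖T‖ ≤ ρ → ‖∑' n, S n * T ^ n‖ ≤ B := fun T hT =>
    tsum_of_norm_bounded hgeo.hasSum (hbound T hT)
  have hmul : ∀ T : ℂ, ‖T‖ ≤ ρ →
      (X * derivative L).eval T = L.eval T * ∑' n, S n * T ^ n := by
    intro T hT
    rw [← (hasSum_coeff_mul_pow (X * derivative L) T).tsum_eq,
      ← (hasSum_coeff_mul_pow L T).tsum_eq,
      tsum_mul_tsum_eq_tsum_sum_antidiagonal_of_summable_norm
        (hasSum_coeff_mul_pow L T).summable.norm (hsum T hT)]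
    congr 1
    ext n
    have : (X * derivative L).coeff n = n * L.coeff n := by
      cases n with
      | zero => simp
      | succ n => rw [coeff_X_mul, coeff_derivative]; push_cast; ring
    rw [this, hN, sum_mul]
    refine sum_congr rfl fun ij hij => ?_
    rw [← HasAntidiagonal.mem_antidiagonal.mp hij, pow_add]
    ring
  obtain ⟨U, hU, hUz⟩ := exists_eq_pow_rootMultiplicity_mul_and_not_dvd L hL0 z
  set m := L.rootMultiplicity z
  have hm : 0 < m := (rootMultiplicity_pos hL0).mpr hz
  obtain ⟨k, hk⟩ : ∃ k, m = k + 1 := ⟨m - 1, by omega⟩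
  set Q : ℂ[X] := X * (((k + 1 : ℕ) : ℂ[X]) * U + (X - C z) * derivative U) with hQ
  have hder : X * derivative L = (X - C z) ^ k * Q := by
    rw [hU, hk, derivative_mul, derivative_X_sub_C_pow, hQ, Nat.add_sub_cancel]
    push_cast
    simp only [map_add, map_natCast, map_one]
    ring
  have hineq : ∀ᶠ T in 𝓝[≠] z, ‖Q.eval T‖ ≤ ‖T - z‖ * ‖U.eval T‖ * B := by
    have h1 : ∀ᶠ T in 𝓝[≠] z, ‖T‖ < ρ :=
      (continuous_norm.tendsto z).mono_left nhdsWithin_le_nhds |>.eventually_lt_const hzρ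
    filter_upwards [h1, self_mem_nhdsWithin] with T hT hTz
    have hTz' : T - z ≠ 0 := sub_ne_zero.mpr hTz
    have h2 := hmul T hT.le
    rw [hder, hU, hk] at h2
    simp only [eval_mul, eval_pow, eval_sub, eval_X, eval_C] at h2
    rw [pow_succ, mul_assoc, mul_assoc] at h2
    have h3 := mul_left_cancel₀ (pow_ne_zero k hTz') h2
    rw [h3, norm_mul, norm_mul, mul_assoc]
    gcongr
    exact hG T hT.le
  have hlim : ‖Q.eval z‖ ≤ ‖z - z‖ * ‖U.eval z‖ * B := by
    refine le_of_tendsto_of_tendsto (b := 𝓝[≠] z) (f := fun T => ‖Q.eval T‖)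
      (g := fun T => ‖T - z‖ * ‖U.eval T‖ * B) ?_ ?_ hineq
    · exact (Continuous.tendsto (by fun_prop) z).mono_left nhdsWithin_le_nhds
    · exact (Continuous.tendsto (by fun_prop) z).mono_left nhdsWithin_le_nhds
  have hUz0 : U.eval z ≠ 0 := fun h => hUz (dvd_iff_isRoot.mpr h)
  have hQz : Q.eval z = 0 := by simpa using hlim
  rw [hQ] at hQz
  simp only [eval_mul, eval_X, eval_add, eval_natCast, eval_sub, eval_C, sub_self, zero_mul,
    add_zero, mul_eq_zero, hz0, hUz0, or_false, false_or] at hQz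
  exact (Nat.cast_ne_zero.mpr (Nat.succ_ne_zero k)) hQz

lemma norm_coeff_one_le_of_newton {L : ℂ[X]} (h0 : L.coeff 0 = 1) {S : ℕ → ℂ} {D R : ℝ}
    (hR : 0 < R) (hS : ∀ n, ‖S n‖ ≤ D * R ^ n)
    (hN : ∀ N : ℕ, N * L.coeff N = ∑ ij ∈ antidiagonal N, L.coeff ij.1 * S ij.2) :
    ‖L.coeff 1‖ ≤ L.natDegree * R := by
  have hL0 : L.eval 0 = 1 := by rw [← coeff_zero_eq_eval_zero, h0]
  have h := (IsAlgClosed.splits L).eval_derivative_div_eval_of_ne_zero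
    (x := 0) (by rw [hL0]; exact one_ne_zero)
  rw [hL0, div_one, ← coeff_zero_eq_eval_zero, coeff_derivative] at h
  simp only [zero_add, Nat.cast_zero, mul_one] at h
  rw [h]
  refine (norm_multiset_sum_le _).trans ?_
  rw [Multiset.map_map]
  refine (Multiset.sum_le_card_nsmul _ R ?_).trans ?_
  · intro x hx
    obtain ⟨z, hz, rfl⟩ := Multiset.mem_map.mp hx
    have hz' := norm_ge_of_isRoot_of_newton h0 hR hS hN (isRoot_of_mem_roots hz)
    simp only [Function.comp_apply, zero_sub, one_div, norm_inv, norm_neg]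
    exact inv_le_of_inv_le₀ hR hz'
  · rw [Multiset.card_map, nsmul_eq_mul]
    gcongr
    exact card_roots' L

end PowerSumBound

section WeilBound

open Polynomial Finset

lemma MulChar.norm_apply_le_one {K : Type*} [Field K] [Fintype K] (χ : MulChar K ℂ) (x : K) :
    ‖χ x‖ ≤ 1 := by
  by_cases hx : x = 0
  · rw [hx, MulChar.map_zero, norm_zero]
    exact zero_le_one
  · refine (Complex.norm_eq_one_of_pow_eq_one (n := Fintype.card K - 1) ?_ ?_).le
    · rw [← map_pow, FiniteField.pow_card_sub_one_eq_one x hx, map_one]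
    · have : 1 < Fintype.card K := Fintype.one_lt_card
      omega

/-- The multiplicative function `h ↦ χ (∏ i, h (c i) ^ e i)` on polynomials. -/
noncomputable def evalChar {F ι : Type*} [Field F] [Fintype ι] (χ : MulChar F ℂ) (c : ι → F) (e : ι → ℕ) :
    F[X] →* ℂ where
  toFun h := χ (∏ i, h.eval (c i) ^ e i)
  map_one' := by simp
  map_mul' a b := by simp only [eval_mul, mul_pow, prod_mul_distrib, map_mul]

lemma evalChar_apply {F ι : Type*} [Field F] [Fintype ι] (χ : MulChar F ℂ) (c : ι → F) (e : ι → ℕ)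
    (h : F[X]) : evalChar χ c e h = χ (∏ i, h.eval (c i) ^ e i) := rfl

lemma sum_evalChar_monicOfDegree_eq_zero {F ι : Type*} [Field F] [Fintype F] [Fintype ι]
    [DecidableEq ι] {χ : MulChar F ℂ} (hχ : χ ≠ 1) {c : ι → F} {e : ι → ℕ} {i₀ : ι} (he : e i₀ = 1)
    (hc : ∀ i ≠ i₀, c i ≠ c i₀) {n : ℕ} (hn : Fintype.card ι ≤ n) :
    ∑ h ∈ monicOfDegree F n, evalChar χ c e h = 0 := by
  obtain ⟨w, hw⟩ := MulChar.ne_one_iff.mp hχ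
  set ℓ : F[X] := ∏ i ∈ univ.erase i₀, (X - C (c i)) with hℓ
  have hℓ0 : ℓ.eval (c i₀) ≠ 0 := by
    rw [hℓ, eval_prod, prod_ne_zero_iff]
    intro i hi
    simpa using sub_ne_zero.mpr (hc i (ne_of_mem_erase hi)).symm
  have hℓi : ∀ i ≠ i₀, ℓ.eval (c i) = 0 := by
    intro i hi
    rw [hℓ, eval_prod]
    exact prod_eq_zero (mem_erase.mpr ⟨hi, mem_univ i⟩) (by simp)
  have hℓd : ℓ.natDegree < n := by
    rw [hℓ, natDegree_prod_of_monic _ _ fun i _ => monic_X_sub_C _]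
    simp only [natDegree_X_sub_C, sum_const, smul_eq_mul, mul_one, card_erase_of_mem (mem_univ i₀)]
    have : 0 < Fintype.card ι := Fintype.card_pos_iff.mpr ⟨i₀⟩
    rw [card_univ]
    omega
  set σ : F → F[X] → F[X] := fun v h => h + C ((v - 1) * h.eval (c i₀) / ℓ.eval (c i₀)) * ℓ with hσ
  have hσ0 : ∀ v h, (σ v h).eval (c i₀) = v * h.eval (c i₀) := by
    intro v h
    simp only [hσ, eval_add, eval_mul, eval_C]
    field_simp
    ring
  have hσi : ∀ v h, ∀ i ≠ i₀, (σ v h).eval (c i) = h.eval (c i) := by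
    intro v h i hi
    simp only [hσ, eval_add, eval_mul, eval_C, hℓi i hi, mul_zero, add_zero]
  have hdeg : ∀ v h, h ∈ monicOfDegree F n → σ v h ∈ monicOfDegree F n := by
    intro v h hh
    obtain ⟨hm, hN⟩ := mem_monicOfDegree.mp hh
    have hlt : (C ((v - 1) * h.eval (c i₀) / ℓ.eval (c i₀)) * ℓ).degree < h.degree := by
      refine degree_lt_degree ((natDegree_C_mul_le _ _).trans_lt ?_)
      rwa [hN]
    refine mem_monicOfDegree.mpr ⟨hm.add_of_left hlt, ?_⟩
    rw [hσ]
    simp only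
    rw [natDegree_eq_of_degree_eq (degree_add_eq_left_of_degree_lt hlt), hN]
  have hinv : ∀ v v' h, v * v' = 1 → σ v (σ v' h) = h := by
    intro v v' h hv
    have h1 := hσ0 v' h
    have : σ v (σ v' h) = σ v' h + C ((v - 1) * (v' * h.eval (c i₀)) / ℓ.eval (c i₀)) * ℓ := by
      rw [← h1]
    rw [this]
    simp only [hσ]
    rw [add_assoc, ← add_mul, ← C_add]
    have : (v' - 1) * h.eval (c i₀) / ℓ.eval (c i₀) +
        (v - 1) * (v' * h.eval (c i₀)) / ℓ.eval (c i₀) = 0 := by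
      rw [← add_div, show (v' - 1) * h.eval (c i₀) + (v - 1) * (v' * h.eval (c i₀)) =
        (v * v' - 1) * h.eval (c i₀) by ring, hv]
      simp
    rw [this]
    simp
  have key : ∑ h ∈ monicOfDegree F n, evalChar χ c e h =
      χ w * ∑ h ∈ monicOfDegree F n, evalChar χ c e h := by
    rw [mul_sum]
    refine (sum_nbij' (σ w) (σ ↑w⁻¹) (hdeg w) (hdeg _)
      (fun h _ => hinv _ _ h (by simp)) (fun h _ => hinv _ _ h (by simp)) fun h _ => ?_).symm
    rw [evalChar_apply, evalChar_apply, ← map_mul]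
    congr 1
    rw [← mul_prod_erase univ _ (mem_univ i₀), ← mul_prod_erase univ _ (mem_univ i₀), he, hσ0,
      ← mul_assoc, pow_one, pow_one]
    congr 1
    exact prod_congr rfl fun i hi => by rw [hσi _ _ _ (ne_of_mem_erase hi)]
  by_contra h0
  exact hw (mul_right_cancel₀ h0 (by rw [one_mul]; exact key.symm))

/-- The composition of a multiplicative character with the norm of a finite extension. -/
noncomputable def MulChar.compNorm {F : Type*} (K : Type*) [Field F] [Field K] [Algebra F K]
    [FiniteDimensional F K] (χ : MulChar F ℂ) : MulChar K ℂ where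
  toFun x := χ (Algebra.norm F x)
  map_one' := by simp
  map_mul' a b := by simp
  map_nonunit' a ha := by
    have : a = 0 := by simpa using ha
    simp [this]

lemma MulChar.compNorm_apply {F : Type*} (K : Type*) [Field F] [Field K] [Algebra F K]
    [FiniteDimensional F K] (χ : MulChar F ℂ) (x : K) :
    χ.compNorm K x = χ (Algebra.norm F x) := rfl

lemma sum_evalChar_minpoly {F K ι : Type*} [Field F] [Field K] [Fintype K] [Algebra F K]
    [FiniteDimensional F K] [Fintype ι] (χ : MulChar F ℂ) (c : ι → F) (e : ι → ℕ) (α : K) :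
    evalChar χ c e (minpoly F α) ^ (Module.finrank F K / (minpoly F α).natDegree) =
      χ.compNorm K (∏ i, (algebraMap F K (c i) - α) ^ e i) := by
  rw [evalChar_apply, MulChar.compNorm_apply, ← map_pow, map_prod, ← prod_pow]
  congr 1
  refine prod_congr rfl fun i _ => ?_
  rw [map_pow, norm_algebraMap_sub_eq_pow, ← pow_mul, ← pow_mul, mul_comm]

lemma norm_sum_compNorm_le {F K ι : Type*} [Field F] [Fintype F] [Field K] [Fintype K]
    [Algebra F K] [Fintype ι] [DecidableEq ι] {χ : MulChar F ℂ} (hχ : χ ≠ 1) {c : ι → F} {e : ι → ℕ}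
    {i₀ : ι} (he : e i₀ = 1) (hc : ∀ i ≠ i₀, c i ≠ c i₀) :
    ‖∑ α : K, χ.compNorm K (∏ i, (algebraMap F K (c i) - α) ^ e i)‖ ≤
      (((Fintype.card F - 1) * (7 * ∑ i, e i + 10) + ∑ i, e i + 3 : ℕ) : ℝ) *
        √(Fintype.card K) := by
  classical
  by_cases hK : 9 ≤ Fintype.card K
  · have hsum : ∑ α : K, χ.compNorm K (∏ i, (algebraMap F K (c i) - α) ^ e i) =
        ∑ β : K, χ.compNorm K ((X * ∏ i ∈ univ.erase i₀,
          (X + C (algebraMap F K (c i - c i₀))) ^ e i : K[X]).eval β) := by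
      refine Fintype.sum_equiv (Equiv.subLeft (algebraMap F K (c i₀))) _ _ fun α => ?_
      congr 1
      rw [eval_mul, eval_prod, eval_X, ← mul_prod_erase univ _ (mem_univ i₀), he, pow_one]
      simp only [Equiv.subLeft_apply, eval_pow, eval_add, eval_X, eval_C]
      congr 1
      refine prod_congr rfl fun i _ => ?_
      rw [map_sub]
      ring
    rw [hsum]
    refine (norm_sum_mulChar_eval_le_sqrt _ _ rfl ?_ (∑ i, e i) ?_ (Fintype.card F - 1) ?_ ?_ hK
      (χ.compNorm K) ?_ ?_).trans ?_
    · rw [eval_prod, prod_ne_zero_iff]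
      intro i hi
      simp only [eval_pow, eval_add, eval_X, eval_C, zero_add]
      refine pow_ne_zero _ ?_
      rw [_root_.map_ne_zero]
      exact sub_ne_zero.mpr (hc i (ne_of_mem_erase hi))
    · refine natDegree_mul_le.trans ?_
      rw [natDegree_X, ← add_sum_erase univ e (mem_univ i₀), he]
      refine Nat.add_le_add_left ((natDegree_prod_le _ _).trans (sum_le_sum fun i _ => ?_)) 1
      rw [natDegree_pow, natDegree_X_add_C, mul_one]
    · have : 1 < Fintype.card F := Fintype.one_lt_card
      omega
    · rw [Module.card_eq_pow_finrank (K := F) (V := K)]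
      simpa using Nat.sub_dvd_pow_sub_pow (Fintype.card F) 1 (Module.finrank F K)
    · intro h
      apply hχ
      ext a
      obtain ⟨b, hb⟩ := FiniteField.norm_surjective F K a
      rw [← hb, ← MulChar.compNorm_apply, h]
      have hb0 : b ≠ 0 := by
        rintro rfl
        simp at hb
        exact a.ne_zero hb.symm
      rw [MulChar.one_apply (isUnit_iff_ne_zero.mpr hb0), hb, MulChar.one_apply a.isUnit]
    · ext a
      rw [MulChar.pow_apply_coe, MulChar.compNorm_apply, ← map_pow, FiniteField.pow_card_sub_one_eq_one,
        map_one, MulChar.one_apply a.isUnit]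
      rw [Algebra.norm_ne_zero_iff]
      exact a.ne_zero
    · rw [add_assoc _ (∑ i, e i) 3]
      gcongr
      omega
  · have hK0 : (0 : ℝ) ≤ Fintype.card K := Nat.cast_nonneg _
    have h3 : √(Fintype.card K : ℝ) ≤ 3 := by
      rw [Real.sqrt_le_left (by norm_num)]
      have : Fintype.card K ≤ 9 := by omega
      calc (Fintype.card K : ℝ) ≤ (9 : ℕ) := by exact_mod_cast this
        _ = _ := by norm_num
    calc _ ≤ ∑ α : K, (1 : ℝ) := norm_sum_le_of_le _ fun α _ => by
            exact MulChar.norm_apply_le_one _ _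
      _ = √(Fintype.card K) * √(Fintype.card K) := by
          rw [Real.mul_self_sqrt hK0]; simp
      _ ≤ _ := by
          gcongr
          refine h3.trans ?_
          push_cast
          have : (0 : ℝ) ≤ ((Fintype.card F - 1 : ℕ) : ℝ) * (7 * (∑ i, (e i : ℝ)) + 10) + ∑ i, (e i : ℝ) := by
            positivity
          linarith

end WeilBound

section WeilBoundPrime

open Polynomial Finset

lemma norm_sum_divisors_irredOfDegree_le {p : ℕ} [Fact p.Prime] {ι : Type*} [Fintype ι]
    [DecidableEq ι] {χ : MulChar (ZMod p) ℂ} (hχ : χ ≠ 1) {c : ι → ZMod p} {e : ι → ℕ}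
    {i₀ : ι} (he : e i₀ = 1) (hc : ∀ i ≠ i₀, c i ≠ c i₀) {n : ℕ} (hn : n ≠ 0) :
    ‖∑ d ∈ n.divisors, (d : ℂ) * ∑ P ∈ irredOfDegree (ZMod p) d, evalChar χ c e P ^ (n / d)‖ ≤
      (((p - 1) * (7 * ∑ i, e i + 10) + ∑ i, e i + 3 : ℕ) : ℝ) * √p ^ n := by
  let : Fintype (GaloisField p n) := Fintype.ofFinite _
  have hfin : Module.finrank (ZMod p) (GaloisField p n) = n := GaloisField.finrank p hn
  have h1 := sum_minpoly_eq (K := GaloisField p n) (evalChar χ c e)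
  rw [hfin] at h1
  rw [← h1]
  have h2 := norm_sum_compNorm_le (K := GaloisField p n) hχ he hc
  rw [sum_congr rfl fun α _ => (sum_evalChar_minpoly χ c e α).symm, hfin, ZMod.card,
    Fintype.card_eq_nat_card, GaloisField.card p n hn] at h2
  have h3 : √((p ^ n : ℕ) : ℝ) = √p ^ n := by
    rw [Nat.cast_pow, Real.sqrt_eq_iff_mul_self_eq (by positivity) (by positivity), ← mul_pow,
      Real.mul_self_sqrt (by positivity)]
  rwa [h3] at h2

/-- Weil's bound for character sums of polynomials that split over `ZMod p` and have a simple
root. -/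
theorem norm_sum_mulChar_prod_le {p : ℕ} [Fact p.Prime] {ι : Type*} [Fintype ι]
    [DecidableEq ι] {χ : MulChar (ZMod p) ℂ} (hχ : χ ≠ 1) (c : ι → ZMod p) (e : ι → ℕ)
    {i₀ : ι} (he : e i₀ = 1) (hc : ∀ i ≠ i₀, c i ≠ c i₀) :
    ‖∑ x : ZMod p, χ (∏ i, (c i - x) ^ e i)‖ ≤ (Fintype.card ι - 1 : ℕ) * √p := by
  set a : ℕ → ℂ := fun n => ∑ h ∈ monicOfDegree (ZMod p) n, evalChar χ c e h with ha
  set L : ℂ[X] := ∑ n ∈ range (Fintype.card ι), C (a n) * X ^ n with hL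
  have hcoeff : ∀ n, L.coeff n = a n := by
    intro n
    rw [hL, finsetSum_coeff]
    simp only [coeff_C_mul, coeff_X_pow, mul_ite, mul_one, mul_zero]
    rw [Finset.sum_ite_eq]
    split_ifs with h
    · rfl
    · exact (sum_evalChar_monicOfDegree_eq_zero hχ he hc (by simpa using h)).symm
  have hdeg : L.natDegree ≤ Fintype.card ι - 1 := by
    refine natDegree_sum_le_of_forall_le _ _ fun n hn => ?_
    refine (natDegree_C_mul_X_pow_le _ _).trans ?_
    have := mem_range.mp hn
    omega
  have h0 : L.coeff 0 = 1 := by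
    rw [hcoeff, ha]
    have : monicOfDegree (ZMod p) 0 = {1} := by
      ext h
      rw [mem_monicOfDegree, mem_singleton]
      constructor
      · rintro ⟨hm, hd⟩
        exact hm.natDegree_eq_zero.mp hd
      · rintro rfl
        exact ⟨monic_one, natDegree_one⟩
    simp only [this, sum_singleton, map_one]
  have h1 : L.coeff 1 = ∑ x : ZMod p, χ (∏ i, (c i - x) ^ e i) := by
    rw [hcoeff, ha]
    symm
    refine sum_bij (fun x _ => X - C x) ?_ ?_ ?_ ?_
    · intro x _
      exact mem_monicOfDegree.mpr ⟨monic_X_sub_C x, natDegree_X_sub_C x⟩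
    · intro x _ y _ h
      exact C_injective (sub_right_injective h)
    · intro h hh
      obtain ⟨hm, hd⟩ := mem_monicOfDegree.mp hh
      refine ⟨-h.coeff 0, mem_univ _, ?_⟩
      rw [hm.eq_X_add_C hd]
      simp
    · intro x _
      rw [evalChar_apply]
      simp
  set S : ℕ → ℂ := fun n => if n = 0 then 0 else
    ∑ d ∈ n.divisors, (d : ℂ) * ∑ P ∈ irredOfDegree (ZMod p) d, evalChar χ c e P ^ (n / d) with hS
  rw [← h1]
  have hp : 0 < √(p : ℝ) := Real.sqrt_pos.mpr (Nat.cast_pos.mpr (Fact.out : p.Prime).pos)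
  refine (norm_coeff_one_le_of_newton h0 (S := S) (R := √p)
    (D := (((p - 1) * (7 * ∑ i, e i + 10) + ∑ i, e i + 3 : ℕ) : ℝ)) hp ?_ ?_).trans ?_
  · intro n
    simp only [hS]
    split_ifs with hn
    · rw [norm_zero]
      positivity
    · exact norm_sum_divisors_irredOfDegree_le hχ he hc hn
  · intro N
    rw [hcoeff, ha]
    simp only
    rw [natCast_mul_sum_monicOfDegree, ← Finset.Nat.sum_antidiagonal_swap,
      Finset.Nat.sum_antidiagonal_eq_sum_range_succ_mk]
    refine sum_subset_zero_on_sdiff ?_ ?_ ?_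
    · intro n hn
      rw [mem_Icc] at hn
      exact mem_range.mpr (by omega)
    · intro n hn
      rw [mem_sdiff, mem_range, mem_Icc] at hn
      have : n = 0 := by omega
      simp [hS, this]
    · intro n hn
      have : n ≠ 0 := by
        rw [mem_Icc] at hn
        omega
      simp only [Prod.swap_prod_mk, hcoeff, hS, if_neg this, ha]
      rw [mul_comm]
  · gcongr

end WeilBoundPrime

section Moments

open Finset

/-- Complex conjugation composed with `χ`, switched on by a Boolean. -/
noncomputable def conjChar {p : ℕ} (χ : MulChar (ZMod p) ℂ) (s : Bool) (y : ZMod p) : ℂ :=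
  if s then χ y else star (χ y)

lemma conjChar_eq_pow {p : ℕ} [Fact p.Prime] (hp2 : p ≠ 2) (χ : MulChar (ZMod p) ℂ) (s : Bool)
    (y : ZMod p) : conjChar χ s y = χ (y ^ (if s then 1 else p - 2)) := by
  unfold conjChar
  have hp : 2 ≤ p := (Fact.out : p.Prime).two_le
  cases s
  · simp only [Bool.false_eq_true, if_false]
    rw [MulChar.star_apply', MulChar.inv_apply']
    congr 1
    by_cases hy : y = 0
    · rw [hy, inv_zero, zero_pow (by omega)]
    · refine inv_eq_of_mul_eq_one_left ?_
      rw [← pow_succ, show p - 2 + 1 = p - 1 by omega]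
      exact ZMod.pow_card_sub_one_eq_one hy
  · simp

lemma star_conjChar {p : ℕ} (χ : MulChar (ZMod p) ℂ) (s : Bool) (y : ZMod p) :
    star (conjChar χ s y) = conjChar χ (!s) y := by
  cases s <;> simp [conjChar]

lemma norm_conjChar_le_one {p : ℕ} [Fact p.Prime] (χ : MulChar (ZMod p) ℂ) (s : Bool)
    (y : ZMod p) : ‖conjChar χ s y‖ ≤ 1 := by
  cases s <;> simpa [conjChar] using MulChar.norm_apply_le_one χ y

lemma norm_sum_prod_conjChar_le {p : ℕ} [Fact p.Prime] (hp2 : p ≠ 2) {ι : Type*} [Fintype ι]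
    [DecidableEq ι] {χ : MulChar (ZMod p) ℂ} (hχ : χ ≠ 1) (s : ι → Bool) (h : ι → ZMod p) {i₀ : ι}
    (hi₀ : ∀ i ≠ i₀, h i ≠ h i₀) :
    ‖∑ x : ZMod p, ∏ i, conjChar χ (s i) (x + h i)‖ ≤ (Fintype.card ι - 1 : ℕ) * √p := by
  wlog hs : s i₀ = true generalizing s
  · have := this (fun i => !s i) (by simpa using hs)
    rw [← norm_star, star_sum]
    simp_rw [star_prod, star_conjChar]
    exact this
  have h1 := norm_sum_mulChar_prod_le hχ h (fun i => if s i then 1 else p - 2) (i₀ := i₀)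
    (by simp [hs]) hi₀
  convert h1 using 2
  refine Fintype.sum_equiv (Equiv.neg _) _ _ fun x => ?_
  rw [map_prod]
  refine prod_congr rfl fun i _ => ?_
  rw [conjChar_eq_pow hp2, Equiv.neg_apply, sub_neg_eq_add, add_comm]

lemma card_forall_exists_ne_eq_le {α : Type*} [DecidableEq α] {r : ℕ} (hr : 0 < r) (T : Finset α)
    {ι : Type*} [Fintype ι] [DecidableEq ι] (hι : Fintype.card ι = 2 * r) :
    #{h ∈ Fintype.piFinset fun _ : ι => T | ∀ i, ∃ j ≠ i, h j = h i} ≤ r ^ (2 * r) * #T ^ r := by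
  classical
  calc _ ≤ #((univ ×ˢ Fintype.piFinset fun _ : Fin r => T).image
        fun uv : (ι → Fin r) × (Fin r → α) => uv.2 ∘ uv.1) := by
        refine card_le_card fun h hh => ?_
        rw [mem_filter, Fintype.mem_piFinset] at hh
        obtain ⟨hT, hh⟩ := hh
        have him : #(univ.image h) ≤ r := by
          have := mul_card_image_le_card_of_maps_to (s := (univ : Finset ι)) (t := univ.image h)
            (f := h) (fun i hi => mem_image_of_mem h hi) 2 ?_
          · rw [card_univ, hι] at this
            omega
          · intro a ha
            obtain ⟨i, -, rfl⟩ := mem_image.mp ha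
            obtain ⟨j, hji, hj⟩ := hh i
            exact one_lt_card.mpr ⟨i, by simp, j, by simp [hj], hji.symm⟩
        have hne : (univ.image h).Nonempty := by
          have : Nonempty ι := Fintype.card_pos_iff.mp (by omega)
          exact univ_nonempty.image h
        obtain ⟨a₀, ha₀⟩ := hne
        let emb : {x // x ∈ univ.image h} ↪ Fin r :=
          (univ.image h).equivFin.toEmbedding.trans (Fin.castLEEmb him)
        have : Nonempty {x // x ∈ univ.image h} := ⟨⟨a₀, ha₀⟩⟩
        refine mem_image.mpr ⟨(fun i => emb ⟨h i, mem_image_of_mem h (mem_univ i)⟩,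
          fun k => (Function.invFun emb k).1), ?_, ?_⟩
        · rw [mem_product, Fintype.mem_piFinset]
          refine ⟨mem_univ _, fun k => ?_⟩
          obtain ⟨i, -, hi⟩ := mem_image.mp (Function.invFun emb k).2
          simp only [← hi]
          exact hT i
        · ext i
          simp only [Function.comp_apply]
          rw [Function.leftInverse_invFun emb.injective]
    _ ≤ _ := card_image_le
    _ = _ := by
        rw [card_product, card_univ, Fintype.card_fun, Fintype.card_fin, hι,
          Fintype.card_piFinset_const]

/-- The `2r`-th moment of short character sums. -/
theorem sum_norm_sum_pow_le {p : ℕ} [Fact p.Prime] (hp2 : p ≠ 2) {χ : MulChar (ZMod p) ℂ}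
    (hχ : χ ≠ 1) {r : ℕ} (hr : 0 < r) {B : ℕ} (hB : B < p) :
    ∑ x : ZMod p, ‖∑ b ∈ Icc 1 B, χ (x + b)‖ ^ (2 * r) ≤
      r ^ (2 * r) * B ^ r * p + 2 * r * B ^ (2 * r) * √p := by
  classical
  set s : Fin r ⊕ Fin r → Bool := Sum.elim (fun _ => true) (fun _ => false) with hs
  set H := Fintype.piFinset fun _ : Fin r ⊕ Fin r => Icc 1 B with hH
  have hι : Fintype.card (Fin r ⊕ Fin r) = 2 * r := by simp; ring
  have hpow : ∀ x : ZMod p, ((‖∑ b ∈ Icc 1 B, χ (x + b)‖ ^ (2 * r) : ℝ) : ℂ) =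
      ∑ h ∈ H, ∏ i, conjChar χ (s i) (x + (h i : ℕ)) := by
    intro x
    rw [hH, ← prod_univ_sum (fun _ => Icc 1 B) (fun i (b : ℕ) => conjChar χ (s i) (x + b)),
      Fintype.prod_sum_type]
    simp only [hs, Sum.elim_inl, Sum.elim_inr, prod_const, card_univ, Fintype.card_fin, conjChar,
      if_true, Bool.false_eq_true, if_false]
    rw [← star_sum, ← mul_pow, pow_mul]
    push_cast
    rw [← Complex.mul_conj']
    rfl
  have hreal : ∑ x : ZMod p, ‖∑ b ∈ Icc 1 B, χ (x + b)‖ ^ (2 * r) =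
      ‖∑ h ∈ H, ∑ x : ZMod p, ∏ i, conjChar χ (s i) (x + (h i : ℕ))‖ := by
    rw [sum_comm, ← sum_congr rfl fun x _ => hpow x, ← Complex.ofReal_sum, Complex.norm_real,
      Real.norm_of_nonneg (by positivity)]
  rw [hreal]
  refine (norm_sum_le _ _).trans ?_
  rw [← sum_filter_add_sum_filter_not H fun h => ∀ i, ∃ j ≠ i, h j = h i]
  refine add_le_add ?_ ?_
  · calc _ ≤ ∑ h ∈ H with ∀ i, ∃ j ≠ i, h j = h i, (p : ℝ) := by
          refine sum_le_sum fun h _ => ?_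
          refine (norm_sum_le_of_le (n := fun _ => 1) _ fun x _ => ?_).trans ?_
          · rw [norm_prod]
            exact prod_le_one (fun _ _ => norm_nonneg _) fun i _ => norm_conjChar_le_one _ _ _
          · simp [ZMod.card]
      _ ≤ _ := by
          rw [sum_const, nsmul_eq_mul]
          gcongr
          have := card_forall_exists_ne_eq_le hr (Icc 1 B) hι
          rw [Nat.card_Icc, Nat.add_sub_cancel] at this
          exact_mod_cast this
  · calc _ ≤ ∑ h ∈ H with ¬ ∀ i, ∃ j ≠ i, h j = h i, (2 * r) * √p := by
          refine sum_le_sum fun h hh => ?_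
          rw [mem_filter, hH, Fintype.mem_piFinset] at hh
          obtain ⟨hT, hh⟩ := hh
          push Not at hh
          obtain ⟨i₀, hi₀⟩ := hh
          refine (norm_sum_prod_conjChar_le hp2 hχ s (fun i => ((h i : ℕ) : ZMod p))
            (i₀ := i₀) ?_).trans ?_
          · intro i hi heq
            have h1 := mem_Icc.mp (hT i)
            have h2 := mem_Icc.mp (hT i₀)
            rw [ZMod.natCast_eq_natCast_iff, Nat.ModEq, Nat.mod_eq_of_lt (by omega),
              Nat.mod_eq_of_lt (by omega)] at heq
            exact hi₀ i hi heq
          · rw [hι]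
            gcongr
            exact_mod_cast Nat.sub_le _ _
      _ ≤ ∑ h ∈ H, (2 * r) * √p := sum_le_sum_of_subset_of_nonneg (filter_subset _ _)
            fun _ _ _ => by positivity
      _ = _ := by
          rw [sum_const, nsmul_eq_mul, hH, Fintype.card_piFinset, prod_const, card_univ, hι, Nat.card_Icc,
            Nat.add_sub_cancel]
          push_cast
          ring

end Moments

section MultiplicativeEnergy

open Finset

lemma sum_gcd_le (a : ℕ) : ∑ b ∈ Ioc 0 a, a.gcd b ≤ a * #a.divisors := by
  rcases Nat.eq_zero_or_pos a with rfl | ha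
  · simp
  calc ∑ b ∈ Ioc 0 a, a.gcd b ≤ ∑ b ∈ Ioc 0 a, ∑ d ∈ a.divisors, if d ∣ b then d else 0 := by
        refine sum_le_sum fun b _ => ?_
        have := single_le_sum (f := fun d => if d ∣ b then d else 0) (s := a.divisors)
          (fun _ _ => Nat.zero_le _) (Nat.mem_divisors.mpr ⟨Nat.gcd_dvd_left a b, ha.ne'⟩)
        simpa [Nat.gcd_dvd_right] using this
    _ = ∑ d ∈ a.divisors, a := by
        rw [sum_comm]
        refine sum_congr rfl fun d hd => ?_
        rw [← sum_filter, sum_const, Nat.Ioc_filter_dvd_card_eq_div, smul_eq_mul,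
          Nat.div_mul_cancel (Nat.dvd_of_mem_divisors hd)]
    _ = _ := by rw [sum_const, smul_eq_mul, mul_comm]

lemma sum_card_divisors_le (A : ℕ) :
    ∑ a ∈ Ioc 0 A, (#a.divisors : ℝ) ≤ A * (1 + Real.log A) := by
  have h1 := ArithmeticFunction.sum_Ioc_sigma0_eq_sum_div A
  simp only [ArithmeticFunction.sigma_zero_apply] at h1
  have h2 := harmonic_le_one_add_log A
  rw [harmonic_eq_sum_Icc] at h2
  calc ∑ a ∈ Ioc 0 A, (#a.divisors : ℝ) = ∑ a ∈ Ioc 0 A, ((A / a : ℕ) : ℝ) := by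
        exact_mod_cast h1
    _ ≤ ∑ a ∈ Ioc 0 A, (A : ℝ) * (a : ℝ)⁻¹ := by
        refine sum_le_sum fun a _ => ?_
        rw [← div_eq_mul_inv]
        exact Nat.cast_div_le
    _ ≤ _ := by
        rw [← mul_sum]
        push_cast at h2
        gcongr
        exact h2

lemma card_filter_mul_add_eq_le {p : ℕ} [Fact p.Prime] {A N a a' : ℕ} (hAN : 2 * A * N ≤ p)
    (ha : a ∈ Ioc 0 A) (ha' : a' ∈ Ioc 0 A) (M : ZMod p) :
    #{t ∈ range N ×ˢ range N | (a' : ZMod p) * (M + (t.1 : ℕ)) = a * (M + (t.2 : ℕ))} ≤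
      1 + N / (a / a.gcd a') := by
  rw [mem_Ioc] at ha ha'
  set g := a.gcd a' with hg
  have hgpos : 0 < g := Nat.gcd_pos_of_pos_left _ ha.1
  obtain ⟨m, hm⟩ := Nat.gcd_dvd_left a a'
  obtain ⟨m', hm'⟩ := Nat.gcd_dvd_right a a'
  rw [← hg] at hm hm'
  have hmpos : 0 < m := Nat.pos_of_ne_zero (by rintro rfl; omega)
  have hdiv : a / g = m := by rw [hm, Nat.mul_div_cancel_left _ hgpos]
  have hcop : IsCoprime (m : ℤ) m' := by
    rw [Nat.isCoprime_iff_coprime]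
    have := Nat.coprime_div_gcd_div_gcd (m := a) (n := a') hgpos
    rw [← hg, hdiv, hm', Nat.mul_div_cancel_left _ hgpos] at this
    exact this
  rw [hdiv, add_comm, ← card_range (N / m + 1)]
  refine card_le_card_of_injOn (fun t => t.1 / m) ?_ ?_
  · intro t ht
    have := mem_range.mp (mem_product.mp (mem_filter.mp ht).1).1
    simp only [coe_range, Set.mem_Iio]
    exact Nat.lt_succ_of_le (Nat.div_le_div_right this.le)
  · rintro ⟨t₁, t₂⟩ ht ⟨u₁, u₂⟩ hu htu
    simp only [coe_filter, mem_product, mem_range, Set.mem_ofPred_eq] at ht hu htu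
    obtain ⟨⟨ht₁, ht₂⟩, ht⟩ := ht
    obtain ⟨⟨hu₁, hu₂⟩, hu⟩ := hu
    have hkey : (a' : ℤ) * (t₁ - u₁) - a * (t₂ - u₂) = 0 := by
      refine Int.eq_zero_of_abs_lt_dvd (m := p) ?_ ?_
      · rw [← ZMod.intCast_zmod_eq_zero_iff_dvd]
        push_cast
        linear_combination ht - hu
      · have h1 : |(t₁ : ℤ) - u₁| < N := by rw [abs_lt]; omega
        have h2 : |(t₂ : ℤ) - u₂| < N := by rw [abs_lt]; omega
        calc _ ≤ |(a' : ℤ) * (t₁ - u₁)| + |(a : ℤ) * (t₂ - u₂)| := abs_sub _ _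
          _ < A * N + A * N := by
            rw [abs_mul, abs_mul, Nat.abs_cast, Nat.abs_cast]
            have : (0 : ℤ) < A := by omega
            refine add_lt_add ?_ ?_
            · calc (a' : ℤ) * |(t₁ : ℤ) - u₁| ≤ A * |(t₁ : ℤ) - u₁| := by gcongr; exact ha'.2
                _ < A * N := by gcongr
            · calc (a : ℤ) * |(t₂ : ℤ) - u₂| ≤ A * |(t₂ : ℤ) - u₂| := by gcongr; exact ha.2
                _ < A * N := by gcongr
          _ ≤ p := by
            have : ((2 * A * N : ℕ) : ℤ) ≤ p := by exact_mod_cast hAN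
            push_cast at this
            linarith
    have hmm : (m' : ℤ) * (t₁ - u₁) = m * (t₂ - u₂) := by
      have hg0 : (g : ℤ) ≠ 0 := by exact_mod_cast hgpos.ne'
      refine mul_left_cancel₀ hg0 ?_
      have e1 : (a : ℤ) = g * m := by exact_mod_cast hm
      have e2 : (a' : ℤ) = g * m' := by exact_mod_cast hm'
      rw [e1, e2] at hkey
      linarith
    have hdvd : (m : ℤ) ∣ t₁ - u₁ := hcop.dvd_of_dvd_mul_left ⟨_, hmm⟩
    have hmod : t₁ % m = u₁ % m := (Nat.modEq_iff_dvd.mpr hdvd).symm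
    have h₁ : t₁ = u₁ := by
      rw [← Nat.div_add_mod t₁ m, htu, hmod, Nat.div_add_mod]
    subst h₁
    have : (t₂ : ℤ) - u₂ = 0 := by
      simpa [hmpos.ne'] using hmm.symm
    rw [Prod.mk.injEq]
    exact ⟨rfl, by omega⟩

lemma card_filter_mul_add_eq_le_div {p : ℕ} [Fact p.Prime] {A N a a' : ℕ} (hAN : 2 * A * N ≤ p)
    (ha : a ∈ Ioc 0 A) (ha' : a' ∈ Ioc 0 A) (M : ZMod p) :
    (#{t ∈ range N ×ˢ range N | (a' : ZMod p) * (M + (t.1 : ℕ)) = a * (M + (t.2 : ℕ))} : ℝ) ≤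
      1 + N * (a.gcd a' / a : ℝ) := by
  calc _ ≤ ((1 + N / (a / a.gcd a') : ℕ) : ℝ) := by
        exact_mod_cast card_filter_mul_add_eq_le hAN ha ha' M
    _ ≤ _ := by
        push_cast
        gcongr
        refine Nat.cast_div_le.trans ?_
        rw [Nat.cast_div (Nat.gcd_dvd_left a a')
          (by exact_mod_cast (Nat.gcd_pos_of_pos_left _ (mem_Ioc.mp ha).1).ne'),
          div_div_eq_mul_div, mul_div_assoc]

lemma card_energy_le {p : ℕ} [Fact p.Prime] {A N : ℕ} (hAN : 2 * A * N ≤ p) (M : ZMod p) :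
    ∑ a ∈ Ioc 0 A, ∑ a' ∈ Ioc 0 A,
      (#{t ∈ range N ×ˢ range N | (a' : ZMod p) * (M + (t.1 : ℕ)) = a * (M + (t.2 : ℕ))} : ℝ) ≤
      A ^ 2 + 2 * N * A * (1 + Real.log A) := by
  set f : ℕ → ℕ → ℝ := fun a a' => if a' ≤ a then N * (a.gcd a' / a : ℝ) else 0 with hf
  have hf0 : ∀ a a', 0 ≤ f a a' := fun a a' => by
    simp only [hf]; split_ifs <;> positivity
  have hsum : ∑ a ∈ Ioc 0 A, ∑ a' ∈ Ioc 0 A, f a a' ≤ N * (A * (1 + Real.log A)) := by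
    calc _ = ∑ a ∈ Ioc 0 A, ∑ a' ∈ Ioc 0 a, N * (a.gcd a' / a : ℝ) := by
          refine sum_congr rfl fun a ha => ?_
          simp only [hf]
          rw [← sum_filter]
          refine sum_congr ?_ fun _ _ => rfl
          ext a'
          rw [mem_Ioc] at ha
          simp only [mem_filter, mem_Ioc]
          omega
      _ ≤ ∑ a ∈ Ioc 0 A, N * (#a.divisors : ℝ) := by
          refine sum_le_sum fun a ha => ?_
          rw [← mul_sum, ← sum_div]
          gcongr
          rw [div_le_iff₀ (by exact_mod_cast (mem_Ioc.mp ha).1), mul_comm]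
          exact_mod_cast sum_gcd_le a
      _ ≤ _ := by
          rw [← mul_sum]
          gcongr
          exact sum_card_divisors_le A
  calc _ ≤ ∑ a ∈ Ioc 0 A, ∑ a' ∈ Ioc 0 A, (1 + f a a' + f a' a) := by
        refine sum_le_sum fun a ha => sum_le_sum fun a' ha' => ?_
        rcases le_total a' a with h | h
        · have := card_filter_mul_add_eq_le_div hAN ha ha' M
          have h1 : f a a' = N * (a.gcd a' / a : ℝ) := if_pos h
          linarith [hf0 a' a]
        · have := card_filter_mul_add_eq_le_div hAN ha' ha M
          have h1 : f a' a = N * (a'.gcd a / a' : ℝ) := if_pos h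
          rw [← h1] at this
          refine le_trans (le_of_eq ?_) (this.trans (by linarith [hf0 a a']))
          congr 1
          refine card_bij (fun t _ => t.swap) ?_ ?_ ?_
          · rintro ⟨t, u⟩ htu
            simp only [mem_filter, mem_product, Prod.swap] at htu ⊢
            exact ⟨htu.1.symm, htu.2.symm⟩
          · rintro x _ y _ hxy
            exact Prod.swap_injective hxy
          · rintro ⟨t, u⟩ htu
            simp only [mem_filter, mem_product] at htu
            refine ⟨(u, t), ?_, rfl⟩
            simp only [mem_filter, mem_product]
            exact ⟨htu.1.symm, htu.2.symm⟩
    _ = A ^ 2 + ∑ a ∈ Ioc 0 A, ∑ a' ∈ Ioc 0 A, f a a' +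
        ∑ a ∈ Ioc 0 A, ∑ a' ∈ Ioc 0 A, f a' a := by
        simp only [sum_add_distrib, sum_const, Nat.card_Ioc]
        simp
        ring
    _ ≤ _ := by
        rw [sum_comm (f := fun a a' => f a' a)]
        linarith

lemma sum_comp_pow_le {J X : Type*} [Fintype X] [DecidableEq X] (S : Finset J) (x : J → X)
    (f : X → ℝ) (hf : ∀ y, 0 ≤ f y) (r : ℕ) :
    (∑ j ∈ S, f (x j)) ^ (2 * (r + 1)) ≤
      #S ^ (2 * r) * #{z ∈ S ×ˢ S | x z.1 = x z.2} * ∑ y, f y ^ (2 * (r + 1)) := by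
  have h1 : (∑ j ∈ S, f (x j)) ^ (r + 1) ≤ #S ^ r * ∑ j ∈ S, f (x j) ^ (r + 1) :=
    pow_sum_le_card_mul_sum_pow (fun _ _ => hf _) r
  have h2 : ∑ j ∈ S, f (x j) ^ (r + 1) = ∑ y, (#{j ∈ S | x j = y} : ℝ) * f y ^ (r + 1) := by
    rw [← sum_fiberwise S x]
    refine sum_congr rfl fun y _ => ?_
    rw [← nsmul_eq_mul, ← sum_const]
    exact sum_congr rfl fun j hj => by rw [(mem_filter.mp hj).2]
  have h3 : (#{z ∈ S ×ˢ S | x z.1 = x z.2} : ℝ) = ∑ y, (#{j ∈ S | x j = y} : ℝ) ^ 2 := by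
    have : #{z ∈ S ×ˢ S | x z.1 = x z.2} = ∑ y, #{j ∈ S | x j = y} ^ 2 := by
      rw [card_eq_sum_card_fiberwise (f := fun z => x z.1) (t := univ) (fun _ _ => by simp)]
      refine sum_congr rfl fun y _ => ?_
      rw [sq, ← card_product]
      congr 1
      ext ⟨i, j⟩
      simp only [mem_filter, mem_product]
      constructor
      · rintro ⟨⟨⟨hi, hj⟩, h⟩, rfl⟩; exact ⟨⟨hi, rfl⟩, hj, h.symm⟩
      · rintro ⟨⟨hi, rfl⟩, hj, h⟩; exact ⟨⟨⟨hi, hj⟩, h.symm⟩, rfl⟩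
    exact_mod_cast this
  calc (∑ j ∈ S, f (x j)) ^ (2 * (r + 1)) = ((∑ j ∈ S, f (x j)) ^ (r + 1)) ^ 2 := by ring
    _ ≤ (#S ^ r * ∑ j ∈ S, f (x j) ^ (r + 1)) ^ 2 :=
        pow_le_pow_left₀ (pow_nonneg (sum_nonneg fun _ _ => hf _) _) h1 2
    _ = #S ^ (2 * r) * (∑ j ∈ S, f (x j) ^ (r + 1)) ^ 2 := by ring
    _ ≤ #S ^ (2 * r) * (#{z ∈ S ×ˢ S | x z.1 = x z.2} * ∑ y, f y ^ (2 * (r + 1))) := by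
        gcongr
        rw [h2, h3]
        refine (sum_mul_sq_le_sq_mul_sq _ _ _).trans (le_of_eq ?_)
        congr 1
        exact sum_congr rfl fun y _ => by ring
    _ = _ := by ring

end MultiplicativeEnergy

section Burgess

open Finset

/-- The sum of `χ` over the `N` consecutive residues starting at `M`. -/
noncomputable def intervalCharSum {p : ℕ} (χ : MulChar (ZMod p) ℂ) (M : ZMod p) (N : ℕ) : ℂ :=
  ∑ t ∈ range N, χ (M + (t : ℕ))

lemma norm_intervalCharSum_le {p : ℕ} [Fact p.Prime] (χ : MulChar (ZMod p) ℂ) (M : ZMod p)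
    (N : ℕ) : ‖intervalCharSum χ M N‖ ≤ N := by
  refine (norm_sum_le_of_le (n := fun _ => 1) _ fun _ _ => MulChar.norm_apply_le_one χ _).trans ?_
  simp

lemma intervalCharSum_add {p : ℕ} (χ : MulChar (ZMod p) ℂ) (M : ZMod p) (m n : ℕ) :
    intervalCharSum χ M (m + n) = intervalCharSum χ M m + intervalCharSum χ (M + (m : ℕ)) n := by
  unfold intervalCharSum
  rw [sum_range_add]
  congr 1
  refine sum_congr rfl fun t _ => ?_
  push_cast
  rw [add_assoc]

lemma norm_intervalCharSum_le_shift {p : ℕ} (χ : MulChar (ZMod p) ℂ) (M : ZMod p) (N h : ℕ)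
    {E : ℝ} (hE : ∀ M', ‖intervalCharSum χ M' h‖ ≤ E) :
    ‖intervalCharSum χ M N - intervalCharSum χ (M + (h : ℕ)) N‖ ≤ 2 * E := by
  have h1 : intervalCharSum χ M N - intervalCharSum χ (M + (h : ℕ)) N =
      intervalCharSum χ M h - intervalCharSum χ (M + (N : ℕ)) h := by
    have e1 := intervalCharSum_add χ M N h
    have e2 := intervalCharSum_add χ M h N
    rw [add_comm] at e1
    linear_combination e2 - e1
  rw [h1]
  linarith [norm_sub_le (intervalCharSum χ M h) (intervalCharSum χ (M + (N : ℕ)) h), hE M,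
    hE (M + (N : ℕ))]

lemma norm_sum_intervalCharSum_le {p : ℕ} [Fact p.Prime] (χ : MulChar (ZMod p) ℂ) (M : ZMod p)
    (N : ℕ) {A : ℕ} (B : ℕ) (hA : A < p) :
    ‖∑ a ∈ Ioc 0 A, ∑ b ∈ Icc 1 B, intervalCharSum χ (M + (a * b : ℕ)) N‖ ≤
      ∑ j ∈ Ioc 0 A ×ˢ range N,
        ‖∑ b ∈ Icc 1 B, χ ((j.1 : ZMod p)⁻¹ * (M + (j.2 : ℕ)) + (b : ℕ))‖ := by
  rw [sum_product]
  refine (norm_sum_le _ _).trans (sum_le_sum fun a ha => ?_)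
  rw [mem_Ioc] at ha
  have ha0 : (a : ZMod p) ≠ 0 := by
    rw [Ne, ZMod.natCast_eq_zero_iff]
    exact Nat.not_dvd_of_pos_of_lt ha.1 (by omega)
  unfold intervalCharSum
  rw [sum_comm]
  refine (norm_sum_le _ _).trans (sum_le_sum fun t _ => ?_)
  have : ∑ b ∈ Icc 1 B, χ (M + (a * b : ℕ) + (t : ℕ)) =
      χ a * ∑ b ∈ Icc 1 B, χ ((a : ZMod p)⁻¹ * (M + (t : ℕ)) + (b : ℕ)) := by
    rw [mul_sum]
    refine sum_congr rfl fun b _ => ?_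
    rw [← map_mul]
    congr 1
    push_cast
    field_simp
    ring
  rw [this, norm_mul]
  exact mul_le_of_le_one_left (norm_nonneg _) (MulChar.norm_apply_le_one χ _)

lemma card_inv_mul_add_eq {p : ℕ} [Fact p.Prime] {A : ℕ} (N : ℕ) (hA : A < p) (M : ZMod p) :
    #{z ∈ (Ioc 0 A ×ˢ range N) ×ˢ (Ioc 0 A ×ˢ range N) |
        (z.1.1 : ZMod p)⁻¹ * (M + (z.1.2 : ℕ)) = (z.2.1 : ZMod p)⁻¹ * (M + (z.2.2 : ℕ))} =
      ∑ a ∈ Ioc 0 A, ∑ a' ∈ Ioc 0 A,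
      #{t ∈ range N ×ˢ range N | (a' : ZMod p) * (M + (t.1 : ℕ)) = a * (M + (t.2 : ℕ))} := by
  have hne : ∀ a ∈ Ioc 0 A, (a : ZMod p) ≠ 0 := by
    intro a ha
    rw [mem_Ioc] at ha
    rw [Ne, ZMod.natCast_eq_zero_iff]
    exact Nat.not_dvd_of_pos_of_lt ha.1 (by omega)
  simp only [card_filter, sum_product]
  refine sum_congr rfl fun a ha => ?_
  rw [sum_comm]
  refine sum_congr rfl fun a' ha' => ?_
  refine sum_congr rfl fun t _ => sum_congr rfl fun u _ => ?_
  have h1 := hne a ha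
  have h2 := hne a' ha'
  refine if_congr ?_ rfl rfl
  rw [inv_mul_eq_iff_eq_mul₀ h1, ← mul_right_inj' h2]
  field_simp

/-- The averaged sum in Burgess' method, bounded by Hölder's inequality. -/
lemma norm_sum_intervalCharSum_pow_le {p : ℕ} [Fact p.Prime] (hp2 : p ≠ 2)
    {χ : MulChar (ZMod p) ℂ} (hχ : χ ≠ 1) {r : ℕ} (hr : 0 < r) {A B N : ℕ} (hB : B < p)
    (hA : 0 < A) (hAN : A ≤ N) (h2AN : 2 * A * N ≤ p) (M : ZMod p) :
    ‖∑ a ∈ Ioc 0 A, ∑ b ∈ Icc 1 B, intervalCharSum χ (M + (a * b : ℕ)) N‖ ^ (2 * r) ≤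
      (A * N : ℝ) ^ (2 * r - 2) * (5 * A * N * Real.log p) *
        (r ^ (2 * r) * B ^ r * p + 2 * r * B ^ (2 * r) * √p) := by
  have hAp : A < p := by nlinarith
  obtain ⟨k, rfl⟩ : ∃ k, r = k + 1 := ⟨r - 1, by omega⟩
  have hlog : 1 ≤ Real.log p := by
    have h3 : (3 : ℝ) ≤ p := by
      have := (Fact.out : p.Prime).two_le
      exact_mod_cast (by omega : 3 ≤ p)
    rw [Real.le_log_iff_exp_le (by linarith)]
    linarith [Real.exp_one_lt_d9]
  have hV : (#{z ∈ (Ioc 0 A ×ˢ range N) ×ˢ (Ioc 0 A ×ˢ range N) |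
        (z.1.1 : ZMod p)⁻¹ * (M + (z.1.2 : ℕ)) = (z.2.1 : ZMod p)⁻¹ * (M + (z.2.2 : ℕ))} : ℝ) ≤
      5 * A * N * Real.log p := by
    rw [card_inv_mul_add_eq N hAp M]
    push_cast
    refine (card_energy_le h2AN M).trans ?_
    have hlogA : Real.log A ≤ Real.log p :=
      Real.log_le_log (by exact_mod_cast hA) (by exact_mod_cast hAp.le)
    have hAN' : (A : ℝ) ≤ N := by exact_mod_cast hAN
    have hA0 : (0 : ℝ) < A := by exact_mod_cast hA
    have hprod : (0 : ℝ) < N * A := by nlinarith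
    nlinarith [mul_le_mul_of_nonneg_left hlogA hprod.le, mul_le_mul_of_nonneg_left hlog hprod.le,
      mul_le_mul_of_nonneg_left hAN' hA0.le]
  calc _ ≤ (∑ j ∈ Ioc 0 A ×ˢ range N,
        ‖∑ b ∈ Icc 1 B, χ ((j.1 : ZMod p)⁻¹ * (M + (j.2 : ℕ)) + (b : ℕ))‖) ^ (2 * (k + 1)) :=
        pow_le_pow_left₀ (norm_nonneg _) (norm_sum_intervalCharSum_le χ M N B hAp) _
    _ ≤ _ := sum_comp_pow_le (Ioc 0 A ×ˢ range N)
        (fun j => (j.1 : ZMod p)⁻¹ * (M + (j.2 : ℕ)))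
        (fun y => ‖∑ b ∈ Icc 1 B, χ (y + (b : ℕ))‖) (fun _ => norm_nonneg _) k
    _ ≤ _ := by
        have h1 : ((#(Ioc 0 A ×ˢ range N) : ℕ) : ℝ) = A * N := by
          rw [card_product, Nat.card_Ioc, card_range]; push_cast; simp
        rw [h1, show 2 * (k + 1) - 2 = 2 * k by omega]
        refine mul_le_mul (mul_le_mul_of_nonneg_left hV (by positivity))
          (sum_norm_sum_pow_le hp2 hχ hr hB) (by positivity) (by positivity)

end Burgess

section BurgessInduction

open Finset

/-- The inductive bound in Burgess' method, written with `q = p ^ (1 / (2 * r))`. -/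
theorem norm_intervalCharSum_le_of_sq_le {p : ℕ} [Fact p.Prime] (hp2 : p ≠ 2)
    {χ : MulChar (ZMod p) ℂ} (hχ : χ ≠ 1) {r : ℕ} (hr : 2 ≤ r) {q : ℝ} (hq1 : 1 ≤ q)
    (hq : q ^ (2 * r) = p) (N : ℕ) (hN : (N : ℝ) ^ 2 ≤ 8 * p * q) (M : ZMod p) :
    ‖intervalCharSum χ M N‖ ≤ 2 * (320 * (r ^ (2 * r) + 2 * r)) *
      (N ^ (2 * r - 2) * q ^ (r + 1) * Real.log p) ^ ((1 : ℝ) / (2 * r)) := by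
  have hp3 : (3 : ℝ) ≤ p := by
    have := (Fact.out : p.Prime).two_le
    exact_mod_cast (by omega : 3 ≤ p)
  have hlog : 1 ≤ Real.log p := by
    rw [Real.le_log_iff_exp_le (by linarith)]
    linarith [Real.exp_one_lt_d9]
  set L := Real.log p
  set κ : ℝ := r ^ (2 * r) + 2 * r with hκ
  have hr2 : (2 : ℝ) ≤ r := by exact_mod_cast hr
  have hκ2 : 4 ≤ κ := by
    have : (0 : ℝ) ≤ r ^ (2 * r) := by positivity
    linarith
  set F : ℕ → ℝ := fun n => n ^ (2 * r - 2) * q ^ (r + 1) * L with hF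
  set G : ℕ → ℝ := fun n => F n ^ ((1 : ℝ) / (2 * r)) with hG
  change _ ≤ 2 * (320 * κ) * G N
  have hF0 : ∀ n, 0 ≤ F n := fun n => by positivity
  have hG0 : ∀ n, 0 ≤ G n := fun n => Real.rpow_nonneg (hF0 n) _
  have hGF : ∀ n, G n ^ (2 * r) = F n := by
    intro n
    rw [hG, ← Real.rpow_natCast, ← Real.rpow_mul (hF0 n)]
    push_cast
    rw [one_div_mul_cancel (by positivity), Real.rpow_one]
  have hle : ∀ {y c : ℝ} {n : ℕ}, 0 ≤ c → y ^ (2 * r) ≤ c ^ (2 * r) * F n → y ≤ c * G n := by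
    intro y c n hc h
    rw [← hGF, ← mul_pow] at h
    exact le_of_pow_le_pow_left₀ (by omega) (mul_nonneg hc (hG0 n)) h
  induction N using Nat.strong_induction_on generalizing M with
  | _ N ih =>
  have hqp : q ≤ p - 1 := by
    refine le_of_pow_le_pow_left₀ two_ne_zero (by linarith) ?_
    calc q ^ 2 ≤ q ^ (2 * r) := pow_le_pow_right₀ hq1 (by omega)
      _ = p := hq
      _ ≤ (p - 1) ^ 2 := by nlinarith
  obtain ⟨B, hBp, hqB, hB2⟩ : ∃ B : ℕ, B < p ∧ q ≤ B ∧ (B : ℝ) ≤ 2 * q := by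
    have hlt := Nat.ceil_lt_add_one (by linarith : 0 ≤ q)
    refine ⟨⌈q⌉₊, ?_, Nat.le_ceil q, by linarith⟩
    have : (⌈q⌉₊ : ℝ) < p := by linarith
    exact_mod_cast this
  have hB1 : (1 : ℝ) ≤ B := hq1.trans hqB
  have hB0 : 0 < B := by exact_mod_cast (by linarith : (0 : ℝ) < B)
  set A := N / (16 * B) with hA
  have hAB : A * (16 * B) ≤ N := Nat.div_mul_le_self _ _
  have hAB' : (A : ℝ) * (16 * B) ≤ N := by exact_mod_cast hAB
  rcases Nat.eq_zero_or_pos A with hA0 | hA0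
  · have hN16 : N < 16 * B := by
      rw [hA] at hA0
      exact (Nat.div_eq_zero_iff.mp hA0).resolve_left (by omega)
    have hN32 : (N : ℝ) ≤ 32 * q := by
      have : (N : ℝ) < 16 * B := by exact_mod_cast hN16
      linarith
    refine (norm_intervalCharSum_le χ M N).trans (hle (by positivity) ?_)
    have hc : (32 : ℝ) ^ 2 ≤ (2 * (320 * κ)) ^ (2 * r) :=
      calc (32 : ℝ) ^ 2 ≤ (2 * (320 * κ)) ^ 2 := by gcongr; linarith
        _ ≤ _ := pow_le_pow_right₀ (by linarith) (by omega)
    calc (N : ℝ) ^ (2 * r) = N ^ 2 * N ^ (2 * r - 2) := by rw [← pow_add]; congr 1; omega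
      _ ≤ (32 * q) ^ 2 * N ^ (2 * r - 2) := by gcongr
      _ = 32 ^ 2 * (N ^ (2 * r - 2) * q ^ 2 * 1) := by ring
      _ ≤ _ := by
          simp only [hF]
          gcongr ?_ * (_ * ?_ * ?_)
          exact pow_le_pow_right₀ hq1 (by omega)
  have hA1 : (1 : ℝ) ≤ A := by exact_mod_cast hA0
  have hNA : (N : ℝ) ≤ 64 * q * A := by
    have h1 : N < (A + 1) * (16 * B) := by
      rw [hA]; exact Nat.lt_mul_of_div_lt (Nat.lt_succ_self _) (by omega)
    have h2 : (N : ℝ) < (A + 1) * (16 * B) := by exact_mod_cast h1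
    nlinarith
  have hAN : A ≤ N := by nlinarith
  have hN0 : (0 : ℝ) < N := by
    have : (A : ℝ) ≤ N := by exact_mod_cast hAN
    linarith
  have h2AN : 2 * A * N ≤ p := by
    have h1 : (A : ℝ) * (16 * q) ≤ N :=
      le_trans (by gcongr) hAB'
    have : (2 * A * N : ℝ) ≤ p := by
      have h2 : (2 * A * N : ℝ) * (8 * q) ≤ p * (8 * q) := by nlinarith
      exact le_of_mul_le_mul_right h2 (by positivity)
    exact_mod_cast this
  set X := ∑ a ∈ Ioc 0 A, ∑ b ∈ Icc 1 B, intervalCharSum χ (M + (a * b : ℕ)) N with hX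
  have hXle : ‖X‖ ≤ (A * B) * (320 * κ) * G N := by
    refine hle (by positivity) ?_
    refine (norm_sum_intervalCharSum_pow_le hp2 hχ (by omega) hBp hA0 hAN h2AN M).trans ?_
    have hsqrt : √p = q ^ r := by
      rw [← hq, mul_comm 2 r, pow_mul, Real.sqrt_sq (by positivity)]
    have hqr : q ^ r ≤ (B : ℝ) ^ r := by gcongr
    calc _ ≤ (A * N : ℝ) ^ (2 * r - 2) * (5 * A * N * L) * (κ * B ^ (2 * r) * q ^ r) := by
          gcongr
          rw [hsqrt, ← hq, hκ]
          have : (B : ℝ) ^ r * q ^ (2 * r) ≤ B ^ (2 * r) * q ^ r :=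
            calc (B : ℝ) ^ r * q ^ (2 * r) = B ^ r * q ^ r * q ^ r := by ring
              _ ≤ B ^ r * B ^ r * q ^ r := by gcongr
              _ = _ := by ring
          have h2 : (0 : ℝ) ≤ r ^ (2 * r) := by positivity
          nlinarith [mul_le_mul_of_nonneg_left this h2]
      _ ≤ (A * N : ℝ) ^ (2 * r - 2) * (5 * A * (64 * q * A) * L) * (κ * B ^ (2 * r) * q ^ r) := by
          gcongr
      _ = (A ^ (2 * r - 2) * A ^ 2 * B ^ (2 * r)) * (320 * κ) *
            (N ^ (2 * r - 2) * (q ^ r * q) * L) := by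
          rw [mul_pow]; ring
      _ = (A * B) ^ (2 * r) * (320 * κ) * F N := by
          rw [← pow_add, show 2 * r - 2 + 2 = 2 * r by omega, ← mul_pow, ← pow_succ]
      _ ≤ (A * B) ^ (2 * r) * (320 * κ) ^ (2 * r) * F N := by
          have := hF0 N
          gcongr
          exact le_self_pow₀ (by linarith) (by omega)
      _ = _ := by rw [← mul_pow]
  have hshift : ∀ a ∈ Ioc 0 A, ∀ b ∈ Icc 1 B,
      ‖intervalCharSum χ M N - intervalCharSum χ (M + (a * b : ℕ)) N‖ ≤ 320 * κ * G N := by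
    intro a ha b hb
    rw [mem_Ioc] at ha
    rw [mem_Icc] at hb
    have hab : a * b * 16 ≤ N := by
      refine le_trans ?_ hAB
      calc a * b * 16 ≤ A * B * 16 := by gcongr <;> omega
        _ = _ := by ring
    have hab0 : 0 < a * b := Nat.mul_pos ha.1 (by omega)
    have habr : ((a * b : ℕ) : ℝ) * 16 ≤ N := by exact_mod_cast hab
    have hGab : G (a * b) ≤ 1 / 4 * G N := by
      refine hle (by norm_num) ?_
      rw [hGF]
      simp only [hF]
      have h1 : ((a * b : ℕ) : ℝ) ^ (2 * r - 2) ≤ (1 / 4) ^ (2 * r) * N ^ (2 * r - 2) :=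
        calc ((a * b : ℕ) : ℝ) ^ (2 * r - 2) ≤ (1 / 16 * N) ^ (2 * r - 2) := by
              gcongr; linarith
          _ = (1 / 4) ^ (2 * (2 * r - 2)) * N ^ (2 * r - 2) := by
              rw [mul_pow, pow_mul]; norm_num
          _ ≤ _ := by
              gcongr ?_ * _
              exact pow_le_pow_of_le_one (by norm_num) (by norm_num) (by omega)
      calc _ ≤ (1 / 4) ^ (2 * r) * (N : ℝ) ^ (2 * r - 2) * q ^ (r + 1) * L := by gcongr
        _ = _ := by ring
    have hsq : ((a * b : ℕ) : ℝ) ^ 2 ≤ 8 * p * q := by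
      refine le_trans ?_ hN
      gcongr
      linarith [(Nat.cast_nonneg (a * b) : (0 : ℝ) ≤ (a * b : ℕ))]
    have := norm_intervalCharSum_le_shift χ M N (a * b)
      (fun M' => ih (a * b) (by omega) hsq M')
    refine this.trans ?_
    calc 2 * (2 * (320 * κ) * G (a * b)) ≤ 2 * (2 * (320 * κ) * (1 / 4 * G N)) := by gcongr
      _ = _ := by ring
  have hAB0 : (0 : ℝ) < A * B := by positivity
  refine le_of_mul_le_mul_left ?_ hAB0
  calc (A * B : ℝ) * ‖intervalCharSum χ M N‖
      = ‖X + ∑ a ∈ Ioc 0 A, ∑ b ∈ Icc 1 B,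
          (intervalCharSum χ M N - intervalCharSum χ (M + (a * b : ℕ)) N)‖ := by
        simp only [hX, sum_sub_distrib, sum_const, Nat.card_Ioc, Nat.card_Icc]
        rw [add_sub_cancel]
        simp [mul_assoc]
    _ ≤ ‖X‖ + ∑ a ∈ Ioc 0 A, ∑ b ∈ Icc 1 B, 320 * κ * G N := by
        refine (norm_add_le _ _).trans ?_
        gcongr
        exact norm_sum_le_of_le _ fun a ha => norm_sum_le_of_le _ fun b hb => hshift a ha b hb
    _ ≤ (A * B) * (320 * κ) * G N + ∑ a ∈ Ioc 0 A, ∑ b ∈ Icc 1 B, 320 * κ * G N := by gcongr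
    _ = _ := by
        simp only [sum_const, Nat.card_Ioc, Nat.card_Icc, nsmul_eq_mul]
        simp
        ring

end BurgessInduction

section LongSums

open Finset

lemma intervalCharSum_mod {p : ℕ} [Fact p.Prime] {χ : MulChar (ZMod p) ℂ} (hχ : χ ≠ 1)
    (M : ZMod p) (N : ℕ) : intervalCharSum χ M (N % p) = intervalCharSum χ M N := by
  have hp0 : 0 < p := (Fact.out : p.Prime).pos
  have hfull : intervalCharSum χ M p = 0 := by
    rw [← MulChar.sum_eq_zero_of_ne_one hχ]
    unfold intervalCharSum
    refine sum_bij (fun t _ => M + (t : ℕ)) (fun _ _ => mem_univ _) ?_ ?_ fun _ _ => rfl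
    · intro s hs t ht hst
      rw [mem_range] at hs ht
      rw [add_right_inj, ZMod.natCast_eq_natCast_iff, Nat.ModEq, Nat.mod_eq_of_lt hs,
        Nat.mod_eq_of_lt ht] at hst
      exact hst
    · intro y _
      exact ⟨(y - M).val, mem_range.mpr (ZMod.val_lt _), by simp⟩
  induction N using Nat.strong_induction_on with
  | _ N ih =>
  rcases lt_or_ge N p with h | h
  · rw [Nat.mod_eq_of_lt h]
  · rw [Nat.mod_eq_sub_mod h, ih (N - p) (by omega)]
    have := intervalCharSum_add χ M p (N - p)
    rw [hfull, zero_add, ZMod.natCast_self, add_zero, Nat.add_sub_cancel' h] at this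
    exact this.symm

lemma norm_intervalCharSum_le_of_blocks {p : ℕ} {χ : MulChar (ZMod p) ℂ} {H : ℕ} (hH : 0 < H)
    {D : ℝ} (hD : ∀ M n, n ≤ H → ‖intervalCharSum χ M n‖ ≤ D) (N : ℕ) (M : ZMod p) :
    ‖intervalCharSum χ M N‖ ≤ (N / H + 1 : ℕ) * D := by
  have hD0 : 0 ≤ D := (norm_nonneg _).trans (hD 0 H le_rfl)
  induction N using Nat.strong_induction_on generalizing M with
  | _ N ih =>
  rcases lt_or_ge N H with h | h
  · rw [Nat.div_eq_of_lt h]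
    simpa using hD M N h.le
  · have h1 := intervalCharSum_add χ M H (N - H)
    rw [Nat.add_sub_cancel' h] at h1
    rw [h1]
    refine (norm_add_le _ _).trans ?_
    have h2 := ih (N - H) (by omega) (M + (H : ℕ))
    have h3 : N / H = (N - H) / H + 1 := by
      rw [← Nat.add_div_right _ hH, Nat.sub_add_cancel h]
    rw [h3]
    push_cast at h2 ⊢
    linarith [hD M H le_rfl]

lemma norm_sum_mul_inv_le_one {p : ℕ} [Fact p.Prime] {χ : MulChar (ZMod p) ℂ} (hχ : χ ≠ 1)
    {b c : ZMod p} (hbc : b ≠ c) : ‖∑ x : ZMod p, χ (x + b) * χ⁻¹ (x + c)‖ ≤ 1 := by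
  have hd : b - c ≠ 0 := sub_ne_zero.mpr hbc
  have h1 : ∑ x : ZMod p, χ (x + b) * χ⁻¹ (x + c) = χ⁻¹ (-1) * jacobiSum χ χ⁻¹ := by
    rw [jacobiSum, mul_sum]
    refine (Fintype.sum_equiv ((Equiv.mulLeft₀ (b - c) hd).trans (Equiv.subRight b)) _ _
      fun y => ?_).symm
    change _ = χ ((b - c) * y - b + b) * χ⁻¹ ((b - c) * y - b + c)
    rw [sub_add_cancel, show (b - c) * y - b + c = (b - c) * (-1 * (1 - y)) by ring, map_mul, map_mul χ⁻¹,
      map_mul χ⁻¹]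
    have h2 : χ (b - c) * χ⁻¹ (b - c) = 1 := by
      rw [← MulChar.mul_apply, mul_inv_cancel, MulChar.one_apply hd.isUnit]
    linear_combination -(χ⁻¹ (-1) * χ y * χ⁻¹ (1 - y)) * h2
  rw [h1, jacobiSum_nontrivial_inv hχ, norm_mul, norm_neg]
  exact mul_le_one₀ (MulChar.norm_apply_le_one _ _) (norm_nonneg _) (MulChar.norm_apply_le_one _ _)

/-- The second moment of short character sums. -/
lemma sum_norm_sum_sq_le {p : ℕ} [Fact p.Prime] {χ : MulChar (ZMod p) ℂ} (hχ : χ ≠ 1) {B : ℕ}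
    (hB : B ≤ p) : ∑ x : ZMod p, ‖∑ b ∈ Icc 1 B, χ (x + b)‖ ^ 2 ≤ B * p + B ^ 2 := by
  have hpow : ∀ x : ZMod p, ((‖∑ b ∈ Icc 1 B, χ (x + b)‖ ^ 2 : ℝ) : ℂ) =
      ∑ b ∈ Icc 1 B, ∑ c ∈ Icc 1 B, χ (x + b) * χ⁻¹ (x + c) := by
    intro x
    rw [← sum_mul_sum]
    push_cast
    rw [← Complex.mul_conj', map_sum]
    congr 1
    exact sum_congr rfl fun c _ => MulChar.star_apply' χ _
  have hreal : ∑ x : ZMod p, ‖∑ b ∈ Icc 1 B, χ (x + b)‖ ^ 2 =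
      ‖∑ b ∈ Icc 1 B, ∑ c ∈ Icc 1 B, ∑ x : ZMod p, χ (x + b) * χ⁻¹ (x + c)‖ := by
    have : ∑ b ∈ Icc 1 B, ∑ c ∈ Icc 1 B, ∑ x : ZMod p, χ (x + b) * χ⁻¹ (x + c) =
        ((∑ x : ZMod p, ‖∑ b ∈ Icc 1 B, χ (x + b)‖ ^ 2 : ℝ) : ℂ) := by
      rw [Complex.ofReal_sum, sum_congr rfl fun x _ => hpow x, sum_comm (s := univ)]
      exact sum_congr rfl fun b _ => sum_comm
    rw [this, Complex.norm_real, Real.norm_of_nonneg (by positivity)]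
  rw [hreal]
  calc _ ≤ ∑ b ∈ Icc 1 B, ∑ c ∈ Icc 1 B, ((if b = c then (p : ℝ) else 0) + 1) := by
        refine norm_sum_le_of_le _ fun b hb => norm_sum_le_of_le _ fun c hc => ?_
        rw [mem_Icc] at hb hc
        split_ifs with hbc
        · refine (norm_sum_le_of_le (n := fun _ => 1) _ fun x _ => ?_).trans (by simp [ZMod.card])
          rw [norm_mul]
          exact mul_le_one₀ (MulChar.norm_apply_le_one _ _) (norm_nonneg _)
            (MulChar.norm_apply_le_one _ _)
        · rw [zero_add]
          refine norm_sum_mul_inv_le_one hχ fun h => hbc ?_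
          rw [ZMod.natCast_eq_natCast_iff] at h
          have := (Nat.modEq_iff_dvd.mp h)
          have h0 := Int.eq_zero_of_abs_lt_dvd this (by rw [abs_lt]; omega)
          omega
    _ = _ := by
        simp only [sum_add_distrib, sum_ite_eq]
        simp
        rw [sum_congr rfl fun b hb => if_pos (mem_Icc.mp hb)]
        simp
        ring

lemma norm_intervalCharSum_le_add_sqrt {p : ℕ} [Fact p.Prime] {χ : MulChar (ZMod p) ℂ}
    (hχ : χ ≠ 1) {N B : ℕ} (hN : N ≤ p) (hB0 : 0 < B) (hB : B ≤ p) (M : ZMod p) :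
    ‖intervalCharSum χ M N‖ ≤ 2 * B + √(2 * (p * N / B)) := by
  have hB0' : (0 : ℝ) < B := by exact_mod_cast hB0
  set X := ∑ b ∈ Icc 1 B, intervalCharSum χ (M + (b : ℕ)) N with hX
  have hXle : ‖X‖ ≤ B * √(2 * (p * N / B)) := by
    have h1 : ‖X‖ ≤ ∑ t ∈ range N, ‖∑ b ∈ Icc 1 B, χ (M + (t : ℕ) + (b : ℕ))‖ := by
      rw [hX]
      unfold intervalCharSum
      rw [sum_comm]
      simp_rw [add_right_comm]
      exact norm_sum_le _ _
    have h2 : (∑ t ∈ range N, ‖∑ b ∈ Icc 1 B, χ (M + (t : ℕ) + (b : ℕ))‖) ^ 2 ≤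
        N * ∑ x : ZMod p, ‖∑ b ∈ Icc 1 B, χ (x + b)‖ ^ 2 := by
      refine sq_sum_le_card_mul_sum_sq.trans ?_
      rw [card_range]
      gcongr
      have hinj : Set.InjOn (fun t : ℕ => M + (t : ZMod p)) (range N) := by
        intro s hs t ht hst
        rw [coe_range, Set.mem_Iio] at hs ht
        rw [add_right_inj, ZMod.natCast_eq_natCast_iff, Nat.ModEq, Nat.mod_eq_of_lt (by omega),
          Nat.mod_eq_of_lt (by omega)] at hst
        exact hst
      rw [← sum_image (f := fun x => ‖∑ b ∈ Icc 1 B, χ (x + b)‖ ^ 2) hinj]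
      exact sum_le_univ_sum_of_nonneg fun _ => by positivity
    refine le_of_sq_le_sq ?_ (by positivity)
    rw [mul_pow, Real.sq_sqrt (by positivity)]
    have hBp : (B : ℝ) ≤ p := by exact_mod_cast hB
    calc ‖X‖ ^ 2 ≤ _ := pow_le_pow_left₀ (norm_nonneg _) h1 2
      _ ≤ _ := h2
      _ ≤ N * (B * p + B ^ 2) := by gcongr; exact sum_norm_sum_sq_le hχ hB
      _ ≤ N * (B * p + B * p) := by gcongr; nlinarith
      _ = _ := by field_simp; ring
  refine le_of_mul_le_mul_left ?_ hB0'
  calc (B : ℝ) * ‖intervalCharSum χ M N‖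
      = ‖X + ∑ b ∈ Icc 1 B,
          (intervalCharSum χ M N - intervalCharSum χ (M + (b : ℕ)) N)‖ := by
        simp only [hX, sum_sub_distrib, sum_const, Nat.card_Icc]
        rw [add_sub_cancel]
        simp
    _ ≤ ‖X‖ + ∑ b ∈ Icc 1 B, (2 * B : ℝ) := by
        refine (norm_add_le _ _).trans ?_
        gcongr
        refine norm_sum_le_of_le _ fun b hb => ?_
        refine norm_intervalCharSum_le_shift χ M N b fun M' =>
          (norm_intervalCharSum_le χ M' b).trans ?_
        exact_mod_cast (mem_Icc.mp hb).2
    _ ≤ B * √(2 * (p * N / B)) + ∑ b ∈ Icc 1 B, (2 * B : ℝ) := by gcongr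
    _ = _ := by
        simp only [sum_const, Nat.card_Icc, nsmul_eq_mul]
        simp
        ring

end LongSums

section BurgessBound

open Finset

lemma one_le_log_of_odd_prime {p : ℕ} (hp : p.Prime) (hp2 : p ≠ 2) : 1 ≤ Real.log p := by
  have h3 : (3 : ℝ) ≤ p := by
    have := hp.two_le
    exact_mod_cast (by omega : 3 ≤ p)
  rw [Real.le_log_iff_exp_le (by linarith)]
  linarith [Real.exp_one_lt_d9]

lemma norm_intervalCharSum_le_of_le_rpow {p : ℕ} [Fact p.Prime] (hp2 : p ≠ 2)
    {χ : MulChar (ZMod p) ℂ} (hχ : χ ≠ 1) {r : ℕ} (hr : 2 ≤ r) (M : ZMod p) (N : ℕ)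
    (hN : (N : ℝ) ≤ (p : ℝ) ^ ((1 : ℝ) / 2 + 1 / (4 * r))) :
    ‖intervalCharSum χ M N‖ ≤ 2 * (320 * (r ^ (2 * r) + 2 * r)) *
      ((N : ℝ) ^ (1 - (1 : ℝ) / r) * (p : ℝ) ^ (((r : ℝ) + 1) / (4 * r ^ 2)) *
        Real.log p ^ ((1 : ℝ) / (2 * r))) := by
  have hp : p.Prime := Fact.out
  have hp1 : (1 : ℝ) ≤ p := by exact_mod_cast hp.one_le
  have hp0 : (0 : ℝ) < p := by linarith
  have hr0 : (0 : ℝ) < r := by exact_mod_cast (by omega : 0 < r)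
  have hlog := one_le_log_of_odd_prime hp hp2
  set q : ℝ := (p : ℝ) ^ ((1 : ℝ) / (2 * r)) with hqdef
  have hq1 : 1 ≤ q := Real.one_le_rpow hp1 (by positivity)
  have hq : q ^ (2 * r) = p := by
    rw [hqdef, ← Real.rpow_natCast, ← Real.rpow_mul hp0.le]
    push_cast
    rw [one_div_mul_cancel (by positivity), Real.rpow_one]
  have hsq : (N : ℝ) ^ 2 ≤ 8 * p * q := by
    calc (N : ℝ) ^ 2 ≤ ((p : ℝ) ^ ((1 : ℝ) / 2 + 1 / (4 * r))) ^ 2 := by gcongr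
      _ = p * q := by
          rw [← Real.rpow_natCast, ← Real.rpow_mul hp0.le, hqdef]
          nth_rw 2 [← Real.rpow_one (p : ℝ)]
          rw [← Real.rpow_add hp0]
          congr 1
          push_cast
          field_simp
          ring
      _ ≤ 8 * p * q := by nlinarith [mul_pos hp0 (by linarith : 0 < q)]
  refine (norm_intervalCharSum_le_of_sq_le hp2 hχ hr hq1 hq N hsq M).trans (le_of_eq ?_)
  congr 1
  rw [Real.mul_rpow (by positivity) (by positivity), Real.mul_rpow (by positivity) (by positivity)]
  congr 2
  · rw [← Real.rpow_natCast, ← Real.rpow_mul (by positivity), Nat.cast_sub (by omega)]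
    congr 1
    push_cast
    field_simp
  · rw [← Real.rpow_natCast, ← Real.rpow_mul (by positivity), hqdef, ← Real.rpow_mul hp0.le]
    congr 1
    push_cast
    field_simp
    norm_num

/-- The exponents of Burgess' inequality with `r = 3`, valid for all lengths `N`. -/
theorem norm_intervalCharSum_le_rpow {p : ℕ} [Fact p.Prime] (hp2 : p ≠ 2)
    {χ : MulChar (ZMod p) ℂ} (hχ : χ ≠ 1) (M : ZMod p) (N : ℕ) :
    ‖intervalCharSum χ M N‖ ≤ 10 ^ 6 * ((N : ℝ) ^ ((2 : ℝ) / 3) * (p : ℝ) ^ ((1 : ℝ) / 9) *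
      Real.log p ^ ((1 : ℝ) / 6)) := by
  have hp : p.Prime := Fact.out
  have hp1 : (1 : ℝ) ≤ p := by exact_mod_cast hp.one_le
  have hp0 : (0 : ℝ) < p := by linarith
  have hlog := one_le_log_of_odd_prime hp hp2
  wlog hNp : N < p generalizing N
  · rw [← intervalCharSum_mod hχ]
    refine (this (N % p) (Nat.mod_lt _ hp.pos)).trans ?_
    gcongr
    exact Nat.mod_le _ _
  rcases Nat.eq_zero_or_pos N with rfl | hN0
  · refine (norm_intervalCharSum_le χ M 0).trans ?_
    rw [Nat.cast_zero]
    positivity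
  have hN1 : (1 : ℝ) ≤ N := by exact_mod_cast hN0
  have hN0' : (0 : ℝ) < N := by linarith
  set L := Real.log p with hL
  have hL0 : 0 ≤ L := by linarith
  set n : ℝ := (N : ℝ) with hn
  have hlog_le : ∀ ε : ℝ, 0 < ε → ε ≤ 1 → L ^ ((1 : ℝ) / 12) ≤ ε⁻¹ * (p : ℝ) ^ (ε / 12) := by
    intro ε hε hε1
    have h1 : L ≤ ε⁻¹ * (p : ℝ) ^ ε := by
      have := Real.log_le_rpow_div hp0.le hε
      rwa [div_eq_inv_mul] at this
    calc L ^ ((1 : ℝ) / 12) ≤ (ε⁻¹ * (p : ℝ) ^ ε) ^ ((1 : ℝ) / 12) := by gcongr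
      _ = ε⁻¹ ^ ((1 : ℝ) / 12) * (p : ℝ) ^ (ε / 12) := by
          rw [Real.mul_rpow (by positivity) (by positivity), ← Real.rpow_mul hp0.le]
          congr 2
          ring
      _ ≤ _ := by
          gcongr
          have h2 : 1 ≤ ε⁻¹ := (one_le_inv₀ hε).mpr hε1
          simpa using Real.rpow_le_rpow_of_exponent_le h2 (by norm_num : (1 : ℝ) / 12 ≤ 1)
  have hLsplit : L ^ ((1 : ℝ) / 4) = L ^ ((1 : ℝ) / 12) * L ^ ((1 : ℝ) / 6) := by
    rw [← Real.rpow_add (by linarith)]; norm_num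
  have hr2 : ∀ (M : ZMod p) (k : ℕ), (k : ℝ) ≤ (p : ℝ) ^ ((5 : ℝ) / 8) →
      ‖intervalCharSum χ M k‖ ≤ 12800 * ((k : ℝ) ^ ((1 : ℝ) / 2) * (p : ℝ) ^ ((3 : ℝ) / 16) *
        (L ^ ((1 : ℝ) / 12) * L ^ ((1 : ℝ) / 6))) := by
    intro M k hk
    have := norm_intervalCharSum_le_of_le_rpow hp2 hχ le_rfl M k (by norm_num at hk ⊢; exact hk)
    rw [← hLsplit]
    norm_num at this ⊢
    exact this
  rcases le_or_gt n ((p : ℝ) ^ ((7 : ℝ) / 12)) with h1 | h1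
  · have := norm_intervalCharSum_le_of_le_rpow hp2 hχ (by norm_num : 2 ≤ 3) M N
      (by norm_num at h1 ⊢; exact h1)
    norm_num at this ⊢
    refine this.trans ?_
    gcongr
    norm_num
  rcases le_or_gt n ((p : ℝ) ^ ((5 : ℝ) / 8)) with h2 | h2
  · refine (hr2 M N h2).trans ?_
    have e1 : (p : ℝ) ^ ((7 : ℝ) / 72) ≤ n ^ ((1 : ℝ) / 6) := by
      calc (p : ℝ) ^ ((7 : ℝ) / 72) = ((p : ℝ) ^ ((7 : ℝ) / 12)) ^ ((1 : ℝ) / 6) := by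
            rw [← Real.rpow_mul hp0.le]; norm_num
        _ ≤ _ := by gcongr
    have e2 := hlog_le (1 / 4) (by norm_num) (by norm_num)
    calc 12800 * (n ^ ((1 : ℝ) / 2) * (p : ℝ) ^ ((3 : ℝ) / 16) *
          (L ^ ((1 : ℝ) / 12) * L ^ ((1 : ℝ) / 6)))
        ≤ 12800 * (n ^ ((1 : ℝ) / 2) * (p : ℝ) ^ ((3 : ℝ) / 16) *
          (((1 : ℝ) / 4)⁻¹ * (p : ℝ) ^ ((1 : ℝ) / 4 / 12) * L ^ ((1 : ℝ) / 6))) := by gcongr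
      _ = 51200 * (n ^ ((1 : ℝ) / 2) * ((p : ℝ) ^ ((1 : ℝ) / 9) * (p : ℝ) ^ ((7 : ℝ) / 72)) *
            L ^ ((1 : ℝ) / 6)) := by
          have : (p : ℝ) ^ ((3 : ℝ) / 16) * (p : ℝ) ^ ((1 : ℝ) / 4 / 12) =
              (p : ℝ) ^ ((1 : ℝ) / 9) * (p : ℝ) ^ ((7 : ℝ) / 72) := by
            rw [← Real.rpow_add hp0, ← Real.rpow_add hp0]; norm_num
          rw [← this]; ring
      _ ≤ 51200 * (n ^ ((1 : ℝ) / 2) * ((p : ℝ) ^ ((1 : ℝ) / 9) * n ^ ((1 : ℝ) / 6)) *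
            L ^ ((1 : ℝ) / 6)) := by gcongr
      _ = 51200 * (n ^ ((2 : ℝ) / 3) * (p : ℝ) ^ ((1 : ℝ) / 9) * L ^ ((1 : ℝ) / 6)) := by
          have : n ^ ((1 : ℝ) / 2) * n ^ ((1 : ℝ) / 6) = n ^ ((2 : ℝ) / 3) := by
            rw [← Real.rpow_add hN0']; norm_num
          rw [← this]; ring
      _ ≤ _ := by gcongr; norm_num
  rcases le_or_gt n ((p : ℝ) ^ ((2 : ℝ) / 3)) with h3 | h3
  · set h : ℝ := (p : ℝ) ^ ((5 : ℝ) / 8) with hh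
    have hh1 : 1 ≤ h := Real.one_le_rpow hp1 (by norm_num)
    have hH0 : 0 < ⌊h⌋₊ := Nat.floor_pos.mpr hh1
    have hHle : (⌊h⌋₊ : ℝ) ≤ h := Nat.floor_le (by linarith)
    have hHge : h / 2 ≤ ⌊h⌋₊ := by
      have h4 := Nat.lt_floor_add_one h
      have h5 : (1 : ℝ) ≤ ⌊h⌋₊ := by exact_mod_cast hH0
      linarith
    refine (norm_intervalCharSum_le_of_blocks hH0 (D := 12800 * (h ^ ((1 : ℝ) / 2) *
      (p : ℝ) ^ ((3 : ℝ) / 16) * (L ^ ((1 : ℝ) / 12) * L ^ ((1 : ℝ) / 6)))) ?_ N M).trans ?_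
    · intro M' k hk
      have hk' : (k : ℝ) ≤ h := le_trans (by exact_mod_cast hk) hHle
      refine (hr2 M' k hk').trans ?_
      gcongr
    have e1 : ((N / ⌊h⌋₊ + 1 : ℕ) : ℝ) ≤ 3 * n * h⁻¹ := by
      push_cast
      have e3 : ((N / ⌊h⌋₊ : ℕ) : ℝ) ≤ n / (h / 2) :=
        Nat.cast_div_le.trans (by gcongr)
      have e4 : 1 ≤ n * h⁻¹ := by
        rw [← div_eq_mul_inv, one_le_div (by linarith)]; exact h2.le
      have e5 : n / (h / 2) = 2 * (n * h⁻¹) := by field_simp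
      linarith
    have e2 := hlog_le (1 / 6) (by norm_num) (by norm_num)
    have e3 : n ≤ n ^ ((2 : ℝ) / 3) * (p : ℝ) ^ ((2 : ℝ) / 9) := by
      calc n = n ^ ((2 : ℝ) / 3) * n ^ ((1 : ℝ) / 3) := by
            rw [← Real.rpow_add hN0']; norm_num
        _ ≤ n ^ ((2 : ℝ) / 3) * ((p : ℝ) ^ ((2 : ℝ) / 3)) ^ ((1 : ℝ) / 3) := by gcongr
        _ = _ := by rw [← Real.rpow_mul hp0.le]; norm_num
    calc _ ≤ (3 * (n ^ ((2 : ℝ) / 3) * (p : ℝ) ^ ((2 : ℝ) / 9)) * h⁻¹) *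
          (12800 * (h ^ ((1 : ℝ) / 2) * (p : ℝ) ^ ((3 : ℝ) / 16) *
          (((1 : ℝ) / 6)⁻¹ * (p : ℝ) ^ ((1 : ℝ) / 6 / 12) * L ^ ((1 : ℝ) / 6)))) := by
          gcongr
          exact e1.trans (by gcongr)
      _ = 230400 * (n ^ ((2 : ℝ) / 3) * (p : ℝ) ^ ((1 : ℝ) / 9) * L ^ ((1 : ℝ) / 6)) := by
          have : (p : ℝ) ^ ((2 : ℝ) / 9) * h⁻¹ * h ^ ((1 : ℝ) / 2) * (p : ℝ) ^ ((3 : ℝ) / 16) *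
              (p : ℝ) ^ ((1 : ℝ) / 6 / 12) = (p : ℝ) ^ ((1 : ℝ) / 9) := by
            rw [hh, ← Real.rpow_neg hp0.le, ← Real.rpow_mul hp0.le, ← Real.rpow_add hp0,
              ← Real.rpow_add hp0, ← Real.rpow_add hp0, ← Real.rpow_add hp0]
            norm_num
          rw [← this]; ring
      _ ≤ _ := by gcongr; norm_num
  · set y : ℝ := (p * n) ^ ((1 : ℝ) / 3) with hy
    have hnp : n ≤ p := Nat.cast_le.mpr hNp.le
    have hpn1 : 1 ≤ p * n := one_le_mul_of_one_le_of_one_le hp1 hN1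
    have hy1 : 1 ≤ y := Real.one_le_rpow hpn1 (by norm_num)
    have hy3 : y ^ 3 = p * n := by
      rw [hy, ← Real.rpow_natCast, ← Real.rpow_mul (by positivity)]; norm_num
    have hyp : y ≤ p := by
      refine le_of_pow_le_pow_left₀ three_ne_zero hp0.le ?_
      rw [hy3]
      nlinarith [mul_le_mul_of_nonneg_left hnp hp0.le, mul_nonneg hp0.le hp0.le]
    have hB0 : 0 < ⌈y⌉₊ := Nat.ceil_pos.mpr (by linarith)
    have hBp : ⌈y⌉₊ ≤ p := Nat.ceil_le.mpr hyp
    have hB2 : (⌈y⌉₊ : ℝ) ≤ 2 * y := by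
      linarith [Nat.ceil_lt_add_one (by linarith : 0 ≤ y)]
    refine (norm_intervalCharSum_le_add_sqrt hχ hNp.le hB0 hBp M).trans ?_
    have e1 : √(2 * (p * n / ⌈y⌉₊)) ≤ 2 * y := by
      rw [Real.sqrt_le_left (by linarith)]
      have : (p * n : ℝ) / ⌈y⌉₊ ≤ y ^ 2 := by
        rw [div_le_iff₀ (by exact_mod_cast hB0), ← hy3]
        nlinarith [Nat.le_ceil y, sq_nonneg y]
      nlinarith [sq_nonneg y]
    have e2 : y ≤ n ^ ((2 : ℝ) / 3) * (p : ℝ) ^ ((1 : ℝ) / 9) * 1 := by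
      have e3 : (p : ℝ) ^ ((2 : ℝ) / 9) ≤ n ^ ((1 : ℝ) / 3) := by
        calc (p : ℝ) ^ ((2 : ℝ) / 9) = ((p : ℝ) ^ ((2 : ℝ) / 3)) ^ ((1 : ℝ) / 3) := by
              rw [← Real.rpow_mul hp0.le]; norm_num
          _ ≤ _ := by gcongr
      calc y = (p : ℝ) ^ ((1 : ℝ) / 3) * n ^ ((1 : ℝ) / 3) := Real.mul_rpow hp0.le hN0'.le
        _ = (p : ℝ) ^ ((1 : ℝ) / 9) * (p : ℝ) ^ ((2 : ℝ) / 9) * n ^ ((1 : ℝ) / 3) := by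
            rw [← Real.rpow_add hp0]; norm_num
        _ ≤ (p : ℝ) ^ ((1 : ℝ) / 9) * n ^ ((1 : ℝ) / 3) * n ^ ((1 : ℝ) / 3) := by gcongr
        _ = _ := by
            rw [mul_assoc, ← Real.rpow_add hN0']; norm_num; ring
    have e4 : 1 ≤ L ^ ((1 : ℝ) / 6) := Real.one_le_rpow hlog (by norm_num)
    calc _ ≤ 6 * y := by linarith
      _ ≤ 6 * (n ^ ((2 : ℝ) / 3) * (p : ℝ) ^ ((1 : ℝ) / 9) * L ^ ((1 : ℝ) / 6)) := by
          gcongr; exact e2.trans (by gcongr)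
      _ ≤ _ := by gcongr; norm_num

end BurgessBound

section SquarefullSums

open Finset

lemma squarefull_sq_mul_cube (a b : ℕ) : Squarefull (a ^ 2 * b ^ 3) := by
  intro q hq hdvd
  rcases (hq.dvd_mul).mp hdvd with h | h
  · exact (pow_dvd_pow_of_dvd (hq.dvd_of_dvd_pow h) 2).mul_right _
  · exact ((pow_dvd_pow_of_dvd (hq.dvd_of_dvd_pow h) 2).trans
      (pow_dvd_pow b (by norm_num))).mul_left _

lemma Squarefull.exists_eq_sq_mul_cube {m : ℕ} (hm : Squarefull m) (hm0 : 0 < m) :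
    ∃ a b : ℕ, 0 < a ∧ 0 < b ∧ Squarefree b ∧ a ^ 2 * b ^ 3 = m := by
  obtain ⟨b, c, hb0, hc0, rfl, hb⟩ := Nat.sq_mul_squarefree_of_pos hm0
  have hbc : b ∣ c := by
    have hsub : b.primeFactors ⊆ c.primeFactors := by
      intro q hq
      have hqp := Nat.prime_of_mem_primeFactors hq
      have hqb := Nat.dvd_of_mem_primeFactors hq
      refine Nat.mem_primeFactors.mpr ⟨hqp, ?_, hc0.ne'⟩
      by_contra hqc
      have h1 : q ^ 2 ∣ b := (((hqp.coprime_iff_not_dvd.mpr hqc).pow 2 2).dvd_of_dvd_mul_left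
        (hm q hqp (hqb.mul_left _)))
      exact hqp.not_isUnit (hb q (by rwa [← sq]))
    rw [← Nat.prod_primeFactors_of_squarefree hb]
    exact (prod_dvd_prod_of_subset _ _ _ hsub).trans (Nat.prod_primeFactors_dvd c)
  obtain ⟨a, rfl⟩ := hbc
  exact ⟨a, b, Nat.pos_of_mul_pos_left hc0, hb0, hb, by ring⟩

lemma squarefree_eq_of_sq_mul_eq {b b' c c' : ℕ} (hb : Squarefree b) (hb' : Squarefree b')
    (hc : c ≠ 0) (hc' : c' ≠ 0) (h : c ^ 2 * b = c' ^ 2 * b') : b = b' := by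
  refine Nat.eq_of_factorization_eq hb.ne_zero hb'.ne_zero fun q => ?_
  have h1 := congrArg (fun n => n.factorization q) h
  simp only [Nat.factorization_mul (pow_ne_zero 2 hc) hb.ne_zero,
    Nat.factorization_mul (pow_ne_zero 2 hc') hb'.ne_zero, Nat.factorization_pow,
    Finsupp.add_apply, Finsupp.smul_apply, smul_eq_mul] at h1
  have h2 := hb.natFactorization_le_one q
  have h3 := hb'.natFactorization_le_one q
  omega

lemma sq_mul_cube_injective {a b a' b' : ℕ} (ha : 0 < a) (ha' : 0 < a') (hb : Squarefree b)
    (hb' : Squarefree b') (h : a ^ 2 * b ^ 3 = a' ^ 2 * b' ^ 3) : a = a' ∧ b = b' := by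
  have hb0 := Nat.pos_of_ne_zero hb.ne_zero
  have hb0' := Nat.pos_of_ne_zero hb'.ne_zero
  obtain rfl : b = b' := squarefree_eq_of_sq_mul_eq hb hb' (Nat.mul_pos ha hb0).ne'
    (Nat.mul_pos ha' hb0').ne' (by linarith)
  refine ⟨?_, rfl⟩
  exact Nat.pow_left_injective two_ne_zero (Nat.eq_of_mul_eq_mul_right (by positivity) h)

open Classical in
lemma sum_squarefull_eq {E : Type*} [AddCommMonoid E] (f : ℕ → E) (X : ℕ) :
    ∑ m ∈ Icc 1 X, (if Squarefull m then f m else 0) =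
      ∑ b ∈ Icc 1 X with Squarefree b, ∑ a ∈ Icc 1 (Nat.sqrt (X / b ^ 3)), f (a ^ 2 * b ^ 3) := by
  rw [← sum_filter, sum_sigma']
  symm
  have hiff : ∀ a b : ℕ, 0 < b → (a ≤ Nat.sqrt (X / b ^ 3) ↔ a ^ 2 * b ^ 3 ≤ X) := by
    intro a b hb
    rw [Nat.le_sqrt', Nat.le_div_iff_mul_le (by positivity)]
  refine sum_bij (fun z _ => z.2 ^ 2 * z.1 ^ 3) ?_ ?_ ?_ fun _ _ => rfl
  · rintro ⟨b, a⟩ h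
    simp only [mem_sigma, mem_filter, mem_Icc] at h ⊢
    have ha : 0 < a := h.2.1
    have hb : 0 < b := h.1.1.1
    exact ⟨⟨Nat.succ_le_of_lt (by positivity), (hiff a b hb).mp h.2.2⟩, squarefull_sq_mul_cube a b⟩
  · rintro ⟨b, a⟩ h ⟨b', a'⟩ h' heq
    simp only [mem_sigma, mem_filter, mem_Icc] at h h'
    obtain ⟨rfl, rfl⟩ := sq_mul_cube_injective h.2.1 h'.2.1 h.1.2 h'.1.2 heq
    rfl
  · intro m hm
    rw [mem_filter, mem_Icc] at hm
    obtain ⟨a, b, ha, hb, hsq, rfl⟩ := hm.2.exists_eq_sq_mul_cube hm.1.1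
    refine ⟨⟨b, a⟩, ?_, rfl⟩
    simp only [mem_sigma, mem_filter, mem_Icc]
    refine ⟨⟨⟨hb, ?_⟩, hsq⟩, ha, (hiff a b hb).mpr hm.1.2⟩
    calc b = 1 * b ^ 1 := by ring
      _ ≤ a ^ 2 * b ^ 3 := Nat.mul_le_mul (Nat.one_le_pow _ _ ha)
          (Nat.pow_le_pow_right hb (by norm_num))
      _ ≤ X := hm.1.2

lemma sum_Icc_mulChar_eq {p : ℕ} (χ : MulChar (ZMod p) ℂ) (N : ℕ) :
    ∑ a ∈ Icc 1 N, χ (a : ℕ) = intervalCharSum χ 1 N := by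
  unfold intervalCharSum
  refine (sum_bij (fun t _ => t + 1) ?_ ?_ ?_ ?_).symm
  · intro t ht
    rw [mem_range] at ht
    exact mem_Icc.mpr ⟨by omega, by omega⟩
  · intro s _ t _ h
    omega
  · intro t ht
    rw [mem_Icc] at ht
    exact ⟨t - 1, mem_range.mpr (by omega), by omega⟩
  · intro t _
    rw [Nat.cast_succ, add_comm]

open Classical in
/-- Sums of a character over square-full numbers. -/
theorem norm_sum_squarefull_le {p : ℕ} [Fact p.Prime] (hp2 : p ≠ 2) {χ : MulChar (ZMod p) ℂ}
    (hχ : χ ^ 2 ≠ 1) {x : ℝ} (hx : 2 ≤ x) :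
    ‖∑ m ∈ Icc 1 ⌊x⌋₊, if Squarefull m then χ (m : ZMod p) else 0‖ ≤
      3 * 10 ^ 6 * (x ^ ((1 : ℝ) / 3) * (p : ℝ) ^ ((1 : ℝ) / 9) * Real.log p ^ ((1 : ℝ) / 6) *
        Real.log x) := by
  have hlog := one_le_log_of_odd_prime (Fact.out : p.Prime) hp2
  set D : ℝ := (p : ℝ) ^ ((1 : ℝ) / 9) * Real.log p ^ ((1 : ℝ) / 6) with hD
  have hD0 : 0 ≤ D := by positivity
  set X := ⌊x⌋₊ with hX
  have hXx : (X : ℝ) ≤ x := Nat.floor_le (by linarith)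
  have hX1 : 1 ≤ X := Nat.le_floor (by push_cast; linarith)
  have hinner : ∀ b ∈ Icc 1 X,
      ‖∑ a ∈ Icc 1 (Nat.sqrt (X / b ^ 3)), χ ((a ^ 2 * b ^ 3 : ℕ) : ZMod p)‖ ≤
        10 ^ 6 * (x ^ ((1 : ℝ) / 3) * D) * (b : ℝ)⁻¹ := by
    intro b hb
    have hb0 : (0 : ℝ) < b := by exact_mod_cast (mem_Icc.mp hb).1
    set N := Nat.sqrt (X / b ^ 3) with hN
    have h1 : ∑ a ∈ Icc 1 N, χ ((a ^ 2 * b ^ 3 : ℕ) : ZMod p) =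
        χ (b : ZMod p) ^ 3 * intervalCharSum (χ ^ 2) 1 N := by
      rw [← sum_Icc_mulChar_eq, mul_sum]
      refine sum_congr rfl fun a _ => ?_
      rw [MulChar.pow_apply' _ two_ne_zero]
      push_cast
      rw [map_mul, map_pow, map_pow, mul_comm]
    have hN2 : (N : ℝ) ^ ((2 : ℝ) / 3) ≤ x ^ ((1 : ℝ) / 3) * (b : ℝ)⁻¹ := by
      have h2 : (N : ℝ) ^ 2 ≤ x / b ^ 3 := by
        calc (N : ℝ) ^ 2 ≤ ((X / b ^ 3 : ℕ) : ℝ) := by exact_mod_cast Nat.sqrt_le' _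
          _ ≤ X / (b ^ 3 : ℕ) := Nat.cast_div_le
          _ ≤ x / b ^ 3 := by push_cast; gcongr
      calc (N : ℝ) ^ ((2 : ℝ) / 3) = ((N : ℝ) ^ 2) ^ ((1 : ℝ) / 3) := by
            rw [← Real.rpow_natCast, ← Real.rpow_mul (by positivity)]; norm_num
        _ ≤ (x / b ^ 3) ^ ((1 : ℝ) / 3) := by gcongr
        _ = x ^ ((1 : ℝ) / 3) * (b : ℝ)⁻¹ := by
            rw [Real.div_rpow (by linarith) (by positivity), ← Real.rpow_natCast,
              ← Real.rpow_mul hb0.le, div_eq_mul_inv]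
            norm_num
    rw [h1, norm_mul, norm_pow]
    calc _ ≤ ‖intervalCharSum (χ ^ 2) 1 N‖ :=
          mul_le_of_le_one_left (norm_nonneg _)
            (pow_le_one₀ (norm_nonneg _) (MulChar.norm_apply_le_one _ _))
      _ ≤ 10 ^ 6 * ((N : ℝ) ^ ((2 : ℝ) / 3) * D) := by
          rw [hD, ← mul_assoc ((N : ℝ) ^ _)]
          exact norm_intervalCharSum_le_rpow hp2 hχ 1 N
      _ ≤ 10 ^ 6 * (x ^ ((1 : ℝ) / 3) * (b : ℝ)⁻¹ * D) := by gcongr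
      _ = _ := by ring
  have hharm : ∑ b ∈ Icc 1 X, (b : ℝ)⁻¹ ≤ 3 * Real.log x := by
    have h2 := harmonic_le_one_add_log X
    rw [harmonic_eq_sum_Icc] at h2
    push_cast at h2
    have h3 : Real.log X ≤ Real.log x := Real.log_le_log (by exact_mod_cast hX1) hXx
    have h4 : Real.log 2 ≤ Real.log x := Real.log_le_log two_pos hx
    linarith [Real.log_two_gt_d9]
  rw [sum_squarefull_eq (fun m => χ (m : ZMod p))]
  calc _ ≤ ∑ b ∈ Icc 1 X with Squarefree b, 10 ^ 6 * (x ^ ((1 : ℝ) / 3) * D) * (b : ℝ)⁻¹ :=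
        norm_sum_le_of_le _ fun b hb => hinner b (mem_filter.mp hb).1
    _ ≤ ∑ b ∈ Icc 1 X, 10 ^ 6 * (x ^ ((1 : ℝ) / 3) * D) * (b : ℝ)⁻¹ :=
        sum_le_sum_of_subset_of_nonneg (filter_subset _ _) fun b _ _ => by positivity
    _ ≤ 10 ^ 6 * (x ^ ((1 : ℝ) / 3) * D) * (3 * Real.log x) := by
        rw [← mul_sum]; gcongr
    _ = _ := by rw [hD]; ring

lemma card_divisors_filter_squarefree_le (n : ℕ) :
    #{d ∈ n.divisors | Squarefree d} ≤ 2 ^ #n.primeFactors := by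
  rw [← card_powerset]
  refine card_le_card_of_injOn Nat.primeFactors ?_ ?_
  · intro d hd
    simp only [coe_filter, Nat.mem_divisors, Set.mem_ofPred_eq] at hd
    exact mem_coe.mpr (mem_powerset.mpr (Nat.primeFactors_mono hd.1.1 hd.1.2))
  · intro d hd e he hde
    simp only [coe_filter, Nat.mem_divisors, Set.mem_ofPred_eq] at hd he
    rw [← Nat.prod_primeFactors_of_squarefree hd.2, hde,
      Nat.prod_primeFactors_of_squarefree he.2]

lemma card_orderOf_dirichletCharacter {p : ℕ} [Fact p.Prime] {d : ℕ} (hd : d ∣ p - 1) :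
    #{χ : DirichletCharacter ℂ p | orderOf χ = d} = d.totient := by
  obtain ⟨e⟩ := DirichletCharacter.mulEquiv_units ℂ p
  have : IsCyclic (DirichletCharacter ℂ p) := isCyclic_of_surjective e.symm e.symm.surjective
  refine IsCyclic.card_orderOf_eq_totient ?_
  rwa [Fintype.card_congr e.toEquiv, ZMod.card_units]

end SquarefullSums

open Classical in
/-- The contribution of characters of order `d > 2` in the counting formula for
square-full primitive roots is `O(2^(ω(p-1)) x^(1/3) p^(1/9) (log p)^(1/6) (log x))`. -/
theorem squarefull_char_sum_higher_order_total :
    ∃ C : ℝ, 0 < C ∧ ∀ (p : ℕ) [Fact p.Prime], Odd p → ∀ x : ℝ, 2 ≤ x →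
      ‖∑ d ∈ (p - 1).divisors.filter (fun d => 2 < d),
          ((ArithmeticFunction.moebius d : ℂ) / (Nat.totient d : ℂ))
            * ∑ χ ∈ Finset.univ.filter (fun χ : DirichletCharacter ℂ p => orderOf χ = d),
                ∑ m ∈ Finset.Icc 1 ⌊x⌋₊, if Squarefull m then χ (m : ZMod p) else 0‖
        ≤ C * 2 ^ (p - 1).primeFactors.card * x ^ ((1 : ℝ)/3) * (p : ℝ) ^ ((1 : ℝ)/9)
          * (Real.log p) ^ ((1 : ℝ)/6) * Real.log x := by
  refine ⟨3 * 10 ^ 6, by norm_num, fun p _ hodd x hx => ?_⟩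
  have hp2 : p ≠ 2 := by rintro rfl; exact absurd hodd (by decide)
  set W : ℝ := 3 * 10 ^ 6 * (x ^ ((1 : ℝ) / 3) * (p : ℝ) ^ ((1 : ℝ) / 9) *
    Real.log p ^ ((1 : ℝ) / 6) * Real.log x) with hW
  have hW0 : 0 ≤ W := by
    have := one_le_log_of_odd_prime (Fact.out : p.Prime) hp2
    have : 0 ≤ Real.log x := Real.log_nonneg (by linarith)
    positivity
  have hterm : ∀ d ∈ (p - 1).divisors.filter (fun d => 2 < d),
      ‖((ArithmeticFunction.moebius d : ℂ) / (Nat.totient d : ℂ)) *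
        ∑ χ ∈ Finset.univ.filter (fun χ : DirichletCharacter ℂ p => orderOf χ = d),
          ∑ m ∈ Finset.Icc 1 ⌊x⌋₊, if Squarefull m then χ (m : ZMod p) else 0‖ ≤
        if Squarefree d then W else 0 := by
    intro d hd
    rw [Finset.mem_filter, Nat.mem_divisors] at hd
    split_ifs with hsq
    · have hφ : (0 : ℝ) < Nat.totient d := by
        exact_mod_cast Nat.totient_pos.mpr (by omega)
      have hμ : ‖(ArithmeticFunction.moebius d : ℂ)‖ ≤ 1 := by
        rw [Complex.norm_intCast]
        exact_mod_cast ArithmeticFunction.abs_moebius_le_one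
      rw [norm_mul, norm_div, Complex.norm_natCast]
      calc _ ≤ 1 / (Nat.totient d : ℝ) *
            ∑ χ ∈ Finset.univ.filter (fun χ : DirichletCharacter ℂ p => orderOf χ = d), W := by
            gcongr
            refine norm_sum_le_of_le _ fun χ hχ => norm_sum_squarefull_le hp2 ?_ hx
            intro h
            have h1 := orderOf_dvd_of_pow_eq_one h
            rw [(Finset.mem_filter.mp hχ).2] at h1
            have := Nat.le_of_dvd two_pos h1
            omega
        _ = W := by
            rw [Finset.sum_const, card_orderOf_dirichletCharacter hd.1.1, nsmul_eq_mul]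
            field_simp
    · rw [ArithmeticFunction.moebius_eq_zero_of_not_squarefree hsq]
      simp
  calc _ ≤ ∑ d ∈ (p - 1).divisors.filter (fun d => 2 < d), if Squarefree d then W else 0 :=
        norm_sum_le_of_le _ hterm
    _ ≤ ∑ d ∈ (p - 1).divisors, if Squarefree d then W else 0 :=
        Finset.sum_le_sum_of_subset_of_nonneg (Finset.filter_subset _ _) fun _ _ _ => by
          split_ifs <;> simp [hW0]
    _ = ((p - 1).divisors.filter Squarefree).card * W := by
        rw [← Finset.sum_filter, Finset.sum_const, nsmul_eq_mul]
    _ ≤ 2 ^ (p - 1).primeFactors.card * W := by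
        gcongr
        have := card_divisors_filter_squarefree_le (p - 1)
        exact_mod_cast this
    _ = _ := by rw [hW]; ring
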